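/- For every integer s ≥ 3, f_{s,s+2}(n) = o(n^{1/2}); that is, f_{s,s+2}(n)/n^{1/2} → 0 as n → ∞. -/

import Mathlib

/-- The Erdős–Rogers function `f_{s,t}(n)`: the minimum over all `K_t`-free graphs `G`
on `n` vertices of the maximum size of a vertex subset inducing a `K_s`-free subgraph. -/
noncomputable def erdosRogers (s t n : ℕ) : ℕ :=
  sInf { k : ℕ | ∃ G : SimpleGraph (Fin n), G.CliqueFree t ∧
    k = sSup { m : ℕ | ∃ A : Finset (Fin n), A.card = m ∧
      (G.induce (A : Set (Fin n))).CliqueFree s } }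


section ERContainers

/-- `P`-sets are covered by at most `N` sets satisfying `Q`. -/
def ERCovers {V : Type} (P Q : Finset V → Prop) (N : ℕ) : Prop :=
  ∃ 𝒟 : Finset (Finset V), 𝒟.card ≤ N ∧ (∀ D ∈ 𝒟, Q D) ∧ ∀ S, P S → ∃ D ∈ 𝒟, S ⊆ D

lemma ERCovers.mono {V : Type} {P P' Q Q' : Finset V → Prop} {N N' : ℕ}
    (h : ERCovers P Q N) (hP : ∀ S, P' S → P S) (hQ : ∀ S, Q S → Q' S) (hN : N ≤ N') :
    ERCovers P' Q' N' := by
  obtain ⟨𝒟, h1, h2, h3⟩ := h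
  exact ⟨𝒟, h1.trans hN, fun D hD => hQ _ (h2 D hD), fun S hS => h3 S (hP S hS)⟩

lemma ERCovers.or {V : Type} {P P' Q : Finset V → Prop} {N N' : ℕ}
    (h : ERCovers P Q N) (h' : ERCovers P' Q N') :
    ERCovers (fun S => P S ∨ P' S) Q (N + N') := by
  classical
  obtain ⟨𝒟, h1, h2, h3⟩ := h
  obtain ⟨𝒟', h1', h2', h3'⟩ := h'
  refine ⟨𝒟 ∪ 𝒟', (Finset.card_union_le _ _).trans (add_le_add h1 h1'), ?_, ?_⟩
  · intro D hD
    rcases Finset.mem_union.1 hD with h | h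
    · exact h2 D h
    · exact h2' D h
  · rintro S (hS | hS)
    · obtain ⟨D, hD, hs⟩ := h3 S hS
      exact ⟨D, Finset.mem_union_left _ hD, hs⟩
    · obtain ⟨D, hD, hs⟩ := h3' S hS
      exact ⟨D, Finset.mem_union_right _ hD, hs⟩

lemma ERCovers.biUnion {V I : Type} (J : Finset I) {P : I → Finset V → Prop}
    {Q : Finset V → Prop} {N : ℕ} (h : ∀ i ∈ J, ERCovers (P i) Q N) :
    ERCovers (fun S => ∃ i ∈ J, P i S) Q (J.card * N) := by
  classical
  choose! F h1 h2 h3 using h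
  refine ⟨J.biUnion F, Finset.card_biUnion_le_card_mul _ _ _ h1, ?_, ?_⟩
  · intro D hD
    obtain ⟨i, hi, hD⟩ := Finset.mem_biUnion.1 hD
    exact h2 i hi D hD
  · rintro S ⟨i, hi, hS⟩
    obtain ⟨D, hD, hs⟩ := h3 i hi S hS
    exact ⟨D, Finset.mem_biUnion.2 ⟨i, hi, hD⟩, hs⟩

open Classical in
/-- number of groups containing `v`. -/
noncomputable def erDeg {V ι : Type} {r : ℕ} (Γ : Finset ι) (c : ι → Fin r → Finset V) (v : V) : ℕ :=
  (Γ.filter (fun γ => ∃ j, v ∈ c γ j)).card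

/-- A linear system of groups, each made of `r` disjoint classes of size `m`. -/
structure ERSys {V ι : Type} (r m Δ : ℕ) (U : Finset V) (Γ : Finset ι)
    (c : ι → Fin r → Finset V) : Prop where
  sub : ∀ γ ∈ Γ, ∀ j, c γ j ⊆ U
  crd : ∀ γ ∈ Γ, ∀ j, (c γ j).card = m
  disj : ∀ γ ∈ Γ, ∀ i j, i ≠ j → Disjoint (c γ i) (c γ j)
  lin : ∀ γ ∈ Γ, ∀ γ' ∈ Γ, ∀ v w, v ≠ w → (∃ j, v ∈ c γ j) → (∃ j, w ∈ c γ j) →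
    (∃ j, v ∈ c γ' j) → (∃ j, w ∈ c γ' j) → γ = γ'
  deg : ∀ v, erDeg Γ c v ≤ Δ

/-- `S` misses some class of every group. -/
def ERValid {V ι : Type} {r : ℕ} (Γ : Finset ι) (c : ι → Fin r → Finset V) (S : Finset V) : Prop :=
  ∀ γ ∈ Γ, ∃ j, Disjoint S (c γ j)

/-- double counting of degrees over a set `W`. -/
lemma erDeg_sum {V ι : Type} {r : ℕ} (Γ : Finset ι) (c : ι → Fin r → Finset V)
    (W : Finset V) [DecidableEq V] (hd : ∀ γ ∈ Γ, ∀ i j, i ≠ j → Disjoint (c γ i) (c γ j)) :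
    ∑ v ∈ W, erDeg Γ c v = ∑ γ ∈ Γ, ∑ j, (c γ j ∩ W).card := by
  classical
  unfold erDeg
  have h1 : ∀ γ ∈ Γ, ∑ j, (c γ j ∩ W).card = (W.filter (fun v => ∃ j, v ∈ c γ j)).card := by
    intro γ hγ
    rw [← Finset.card_biUnion]
    · congr 1
      ext v
      simp [and_comm]
    · intro i _ j _ hij
      exact (hd γ hγ i j hij).mono Finset.inter_subset_left Finset.inter_subset_left
  rw [Finset.sum_congr rfl h1]
  simp only [Finset.card_filter]
  rw [Finset.sum_comm]
  refine Finset.sum_congr rfl fun γ _ => Finset.sum_congr rfl fun v _ => ?_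
  congr

/-- one step of the container algorithm: structure of the state. -/
structure ERState {V ι : Type} (r m' Δ : ℕ) (U : Finset V) (Γ : Finset ι)
    (c : ι → Fin (r + 1) → Finset V) (Γ' : Finset ι) (c' : ι → Fin r → Finset V) : Prop where
  sys : ERSys r m' Δ U Γ' c'
  sub : Γ' ⊆ Γ
  supp : ∀ γ ∈ Γ', ∀ j, ∃ i, c' γ j ⊆ c γ i

open Classical in
lemma er_pick {V ι : Type} {r m m' Δ Δ' : ℕ} {U : Finset V} {Γ : Finset ι}
    {c : ι → Fin (r + 1) → Finset V} {Γ' : Finset ι} {c' : ι → Fin r → Finset V}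
    (hs : ERSys (r + 1) m Δ U Γ c) (hst : ERState r m' Δ' U Γ c Γ' c')
    (hm : 2 * m' ≤ m + 1) (x : V) (Γc : Finset ι)
    (hΓc : ∀ γ ∈ Γc, γ ∈ Γ ∧ γ ∉ Γ' ∧
      ∀ j, 2 * (c γ j ∩ U.filter (fun v => Δ' ≤ erDeg Γ' c' v)).card ≤ m) :
    ∃ Γ'' c'', ERState r m' Δ' U Γ c Γ'' c'' ∧
      Γ''.card = Γ'.card + erDeg Γc c x ∧
      ∀ S, x ∈ S → ERValid Γ c S → ERValid Γ' c' S → ERValid Γ'' c'' S := by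
  set Sat := U.filter (fun v => Δ' ≤ erDeg Γ' c' v) with hSat
  set X := Γc.filter (fun γ => ∃ j, x ∈ c γ j) with hX
  have hXΓ : ∀ γ ∈ X, γ ∈ Γ := fun γ h => (hΓc γ (Finset.mem_filter.1 h).1).1
  have hXn : ∀ γ ∈ X, γ ∉ Γ' := fun γ h => (hΓc γ (Finset.mem_filter.1 h).1).2.1
  have hh : ∀ γ ∈ X, ∃ h : Fin (r + 1), x ∈ c γ h := fun γ h => (Finset.mem_filter.1 h).2
  choose! h hxh using hh
  have hch : ∀ γ ∈ X, ∀ j : Fin r, ∃ t : Finset V, t ⊆ c γ ((h γ).succAbove j) \ Sat ∧ t.card = m' := by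
    intro γ hγ j
    apply Finset.exists_subset_card_eq
    have h1 := (hΓc γ (Finset.mem_filter.1 hγ).1).2.2 ((h γ).succAbove j)
    have h2 := hs.crd γ (hXΓ γ hγ) ((h γ).succAbove j)
    have h3 := Finset.card_sdiff_add_card_inter (c γ ((h γ).succAbove j)) Sat
    omega
  choose! t ht htc using hch
  have htsub : ∀ γ ∈ X, ∀ j, t γ j ⊆ c γ ((h γ).succAbove j) := fun γ hγ j =>
    (ht γ hγ j).trans Finset.sdiff_subset
  have hdisj : Disjoint Γ' X := by
    rw [Finset.disjoint_right]; exact hXn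
  have hsupp : ∀ γ ∈ Γ' ∪ X, ∀ j, ∃ i, (if γ ∈ X then t γ j else c' γ j) ⊆ c γ i := by
    intro γ hγ j
    by_cases hx : γ ∈ X
    · simp only [hx, if_true]
      exact ⟨_, htsub γ hx j⟩
    · simp only [hx, if_false]
      exact hst.supp γ ((Finset.mem_union.1 hγ).resolve_right hx) j
  have hΓ'' : Γ' ∪ X ⊆ Γ := Finset.union_subset hst.sub hXΓ
  refine ⟨Γ' ∪ X, fun γ j => if γ ∈ X then t γ j else c' γ j, ⟨⟨?_, ?_, ?_, ?_, ?_⟩, hΓ'', hsupp⟩, ?_, ?_⟩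
  · intro γ hγ j
    obtain ⟨i, hi⟩ := hsupp γ hγ j
    exact hi.trans (hs.sub γ (hΓ'' hγ) i)
  · intro γ hγ j
    by_cases hx : γ ∈ X
    · simp only [hx, if_true]; exact htc γ hx j
    · simp only [hx, if_false]
      exact hst.sys.crd γ ((Finset.mem_union.1 hγ).resolve_right hx) j
  · intro γ hγ i j hij
    by_cases hx : γ ∈ X
    · simp only [hx, if_true]
      exact (hs.disj γ (hXΓ γ hx) _ _ (fun h' => hij (Fin.succAbove_right_injective h'))).mono
        (htsub γ hx i) (htsub γ hx j)
    · simp only [hx, if_false]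
      exact hst.sys.disj γ ((Finset.mem_union.1 hγ).resolve_right hx) i j hij
  · intro γ hγ γ' hγ' v w hvw h1 h2 h3 h4
    have key : ∀ γ ∈ Γ' ∪ X, ∀ v, (∃ j, v ∈ if γ ∈ X then t γ j else c' γ j) → ∃ j, v ∈ c γ j := by
      rintro γ hγ v ⟨j, hj⟩
      obtain ⟨i, hi⟩ := hsupp γ hγ j
      exact ⟨i, hi hj⟩
    exact hs.lin γ (hΓ'' hγ) γ' (hΓ'' hγ') v w hvw (key γ hγ v h1) (key γ hγ w h2)
      (key γ' hγ' v h3) (key γ' hγ' w h4)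
  · intro v
    have hsplit : erDeg (Γ' ∪ X) (fun γ j => if γ ∈ X then t γ j else c' γ j) v
        ≤ erDeg Γ' c' v + (X.filter (fun γ => ∃ j, v ∈ t γ j)).card := by
      unfold erDeg
      rw [Finset.filter_union]
      refine (Finset.card_union_le _ _).trans (add_le_add (Finset.card_le_card ?_) (Finset.card_le_card ?_))
      · intro γ hγ
        rw [Finset.mem_filter] at hγ ⊢
        have : γ ∉ X := fun hx => hXn γ hx hγ.1
        simpa [this] using hγ
      · intro γ hγ
        rw [Finset.mem_filter] at hγ ⊢
        have := hγ.1
        simpa [this] using hγ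
    have hd' := hst.sys.deg v
    by_cases hemp : X.filter (fun γ => ∃ j, v ∈ t γ j) = ∅
    · rw [hemp] at hsplit; simp at hsplit; omega
    · obtain ⟨γ, hγ⟩ := Finset.nonempty_iff_ne_empty.2 hemp
      have hγX := (Finset.mem_filter.1 hγ).1
      obtain ⟨j, hj⟩ := (Finset.mem_filter.1 hγ).2
      have hvc := ht γ hγX j hj
      rw [Finset.mem_sdiff] at hvc
      have hvU : v ∈ U := hs.sub γ (hXΓ γ hγX) _ hvc.1
      have hns : ¬ Δ' ≤ erDeg Γ' c' v := fun hle => hvc.2 (Finset.mem_filter.2 ⟨hvU, hle⟩)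
      have hvx : x ≠ v := by
        rintro rfl
        have := hs.disj γ (hXΓ γ hγX) (h γ) ((h γ).succAbove j) (Fin.succAbove_ne _ _).symm
        exact Finset.disjoint_left.1 this (hxh γ hγX) hvc.1
      have hone : (X.filter (fun γ => ∃ j, v ∈ t γ j)).card ≤ 1 := by
        rw [Finset.card_le_one]
        intro γ1 h1 γ2 h2
        obtain ⟨h1X, j1, hj1⟩ := Finset.mem_filter.1 h1
        obtain ⟨h2X, j2, hj2⟩ := Finset.mem_filter.1 h2
        exact hs.lin γ1 (hXΓ _ h1X) γ2 (hXΓ _ h2X) x v hvx ⟨_, hxh γ1 h1X⟩ ⟨_, htsub γ1 h1X j1 hj1⟩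
          ⟨_, hxh γ2 h2X⟩ ⟨_, htsub γ2 h2X j2 hj2⟩
      omega
  · rw [Finset.card_union_of_disjoint hdisj]; simp only [erDeg, hX]
  · intro S hxS hV hV' γ hγ
    by_cases hx : γ ∈ X
    · obtain ⟨i, hi⟩ := hV γ (hXΓ γ hx)
      have hne : i ≠ h γ := by
        rintro rfl
        exact Finset.disjoint_left.1 hi hxS (hxh γ hx)
      obtain ⟨j, rfl⟩ := Fin.exists_succAbove_eq hne
      refine ⟨j, ?_⟩
      simp only [hx, if_true]
      exact hi.mono_right (htsub γ hx j)
    · obtain ⟨j, hj⟩ := hV' γ ((Finset.mem_union.1 hγ).resolve_right hx)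
      refine ⟨j, ?_⟩
      simpa only [hx, if_false] using hj

end ERContainers

section ERContainers2

open Classical in
lemma er_cur {V ι : Type} {r m m' L : ℕ} {U : Finset V} {Γ : Finset ι}
    {c : ι → Fin (r + 1) → Finset V} {Γ' : Finset ι} {c' : ι → Fin r → Finset V}
    (hs : ERSys (r + 1) m (L ^ (r + 1)) U Γ c) (hst : ERState r m' (L ^ r) U Γ c Γ' c')
    (hm' : m' ≤ m) (hm : 0 < m) (hL : 0 < L)
    (hhalt : 8 * (r + 1) * L * Γ'.card < Γ.card) :
    Γ.card ≤ 2 * (Γ.filter (fun γ => γ ∉ Γ' ∧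
      ∀ j, 2 * (c γ j ∩ U.filter (fun v => L ^ r ≤ erDeg Γ' c' v)).card ≤ m)).card := by
  set Sat := U.filter (fun v => L ^ r ≤ erDeg Γ' c' v) with hSat
  set Del := Γ.filter (fun γ => ∃ j, m < 2 * (c γ j ∩ Sat).card) with hDel
  have h1 : Sat.card * L ^ r ≤ r * m' * Γ'.card := by
    calc Sat.card * L ^ r = ∑ v ∈ Sat, L ^ r := by simp
      _ ≤ ∑ v ∈ Sat, erDeg Γ' c' v := Finset.sum_le_sum fun v hv => (Finset.mem_filter.1 hv).2
      _ = ∑ γ ∈ Γ', ∑ j, (c' γ j ∩ Sat).card := erDeg_sum Γ' c' Sat hst.sys.disj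
      _ ≤ ∑ γ ∈ Γ', r * m' := by
          refine Finset.sum_le_sum fun γ hγ => ?_
          calc ∑ j, (c' γ j ∩ Sat).card ≤ ∑ j : Fin r, m' :=
                Finset.sum_le_sum fun j _ => (Finset.card_le_card Finset.inter_subset_left).trans
                  (hst.sys.crd γ hγ j).le
            _ = r * m' := by simp
      _ = r * m' * Γ'.card := by simp [mul_comm]
  have h2 : Del.card * m ≤ 2 * (Sat.card * L ^ (r + 1)) := by
    calc Del.card * m = ∑ γ ∈ Del, m := by simp
      _ ≤ ∑ γ ∈ Del, 2 * ∑ j, (c γ j ∩ Sat).card := by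
          refine Finset.sum_le_sum fun γ hγ => ?_
          obtain ⟨j, hj⟩ := (Finset.mem_filter.1 hγ).2
          have := Finset.single_le_sum (f := fun j => (c γ j ∩ Sat).card) (fun _ _ => Nat.zero_le _)
            (Finset.mem_univ j)
          omega
      _ ≤ ∑ γ ∈ Γ, 2 * ∑ j, (c γ j ∩ Sat).card :=
          Finset.sum_le_sum_of_subset (Finset.filter_subset _ _)
      _ = 2 * ∑ v ∈ Sat, erDeg Γ c v := by
          rw [← Finset.mul_sum, erDeg_sum Γ c Sat hs.disj]
      _ ≤ 2 * ∑ v ∈ Sat, L ^ (r + 1) := by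
          gcongr with v hv
          exact hs.deg v
      _ = _ := by simp
  have h3 : Del.card ≤ 2 * L * r * Γ'.card := by
    have : Del.card * m ≤ (2 * L * r * Γ'.card) * m := by
      calc Del.card * m ≤ 2 * (Sat.card * L ^ (r + 1)) := h2
        _ = 2 * L * (Sat.card * L ^ r) := by ring
        _ ≤ 2 * L * (r * m' * Γ'.card) := by gcongr
        _ ≤ 2 * L * (r * m * Γ'.card) := by gcongr
        _ = _ := by ring
    exact Nat.le_of_mul_le_mul_right this hm
  have h4 : Γ.card ≤ (Γ.filter (fun γ => γ ∉ Γ' ∧ ∀ j, 2 * (c γ j ∩ Sat).card ≤ m)).card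
      + Γ'.card + Del.card := by
    calc Γ.card ≤ ((Γ.filter (fun γ => γ ∉ Γ' ∧ ∀ j, 2 * (c γ j ∩ Sat).card ≤ m)) ∪ Γ' ∪ Del).card := by
          apply Finset.card_le_card
          intro γ hγ
          by_cases h1 : γ ∈ Γ'
          · simp [h1]
          · by_cases h2 : ∃ j, m < 2 * (c γ j ∩ Sat).card
            · simp only [Finset.mem_union]; right
              exact Finset.mem_filter.2 ⟨hγ, h2⟩
            · push Not at h2
              simp only [Finset.mem_union]; left; left
              exact Finset.mem_filter.2 ⟨hγ, h1, h2⟩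
      _ ≤ _ := (Finset.card_union_le _ _).trans (Nat.add_le_add_right (Finset.card_union_le _ _) _)
  have h5 : 2 * L * r * Γ'.card + Γ'.card ≤ 4 * (r + 1) * L * Γ'.card := by
    have : 2 * L * r + 1 ≤ 4 * (r + 1) * L := by nlinarith
    nlinarith
  have h6 : 8 * (r + 1) * L * Γ'.card = 2 * (4 * (r + 1) * L * Γ'.card) := by ring
  omega

open Classical in
lemma er_high {V ι : Type} {r m Δ a : ℕ} {U : Finset V} {Γ Γc : Finset ι}
    {c : ι → Fin (r + 1) → Finset V} (hs : ERSys (r + 1) m Δ U Γ c) (hsub : Γc ⊆ Γ)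
    (hcard : Γ.card ≤ 2 * Γc.card) (hden : Δ * U.card ≤ a * m * Γ.card) (hΔ : 0 < Δ) :
    U.card ≤ 4 * a * (U.filter (fun x => Δ ≤ 4 * a * erDeg Γc c x)).card := by
  set H := U.filter (fun x => Δ ≤ 4 * a * erDeg Γc c x) with hH
  have hdle : ∀ v, erDeg Γc c v ≤ Δ := fun v =>
    (Finset.card_le_card (Finset.filter_subset_filter _ hsub)).trans (hs.deg v)
  have h1 : m * Γc.card ≤ ∑ v ∈ U, erDeg Γc c v := by
    rw [erDeg_sum Γc c U (fun γ hγ => hs.disj γ (hsub hγ))]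
    calc m * Γc.card = ∑ γ ∈ Γc, m := by simp [mul_comm]
      _ ≤ _ := by
        refine Finset.sum_le_sum fun γ hγ => ?_
        have := Finset.single_le_sum (f := fun j => (c γ j ∩ U).card) (fun _ _ => Nat.zero_le _)
            (Finset.mem_univ (0 : Fin (r + 1)))
        simp only [Finset.inter_eq_left.2 (hs.sub γ (hsub hγ) _), hs.crd γ (hsub hγ)] at this
        simpa [Finset.inter_eq_left.2 (hs.sub γ (hsub hγ) _), hs.crd γ (hsub hγ)] using this
  have h2 : 4 * a * ∑ v ∈ U, erDeg Γc c v ≤ 4 * a * (H.card * Δ) + U.card * Δ := by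
    rw [Finset.mul_sum]
    calc ∑ v ∈ U, 4 * a * erDeg Γc c v ≤ ∑ v ∈ U, ((if v ∈ H then 4 * a * Δ else 0) + Δ) := by
          refine Finset.sum_le_sum fun v hv => ?_
          by_cases hvH : v ∈ H
          · simp only [hvH, if_true]
            have := Nat.mul_le_mul_left (4 * a) (hdle v)
            omega
          · simp only [hvH, if_false]
            have : ¬ Δ ≤ 4 * a * erDeg Γc c v := fun h => hvH (Finset.mem_filter.2 ⟨hv, h⟩)
            omega
      _ = _ := by
          rw [Finset.sum_add_distrib, ← Finset.sum_filter]
          have : U.filter (fun v => v ∈ H) = H := by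
            ext v; simp [hH]
          rw [this]; simp; ring
  have h3 : Δ * U.card * 2 ≤ 4 * a * (H.card * Δ) + U.card * Δ := by
    calc Δ * U.card * 2 ≤ a * m * Γ.card * 2 := by gcongr
      _ ≤ a * m * (2 * Γc.card) * 2 := by gcongr
      _ = 4 * a * (m * Γc.card) := by ring
      _ ≤ _ := (Nat.mul_le_mul_left _ h1).trans h2
  have h4 : U.card * Δ ≤ (4 * a * H.card) * Δ := by nlinarith
  exact Nat.le_of_mul_le_mul_right h4 hΔ

theorem er_container (r : ℕ) : ∀ a : ℕ, 0 < a → ∃ A C : ℕ, 0 < A ∧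
    ∀ (V ι : Type) (U : Finset V) (m L b : ℕ) (Γ : Finset ι) (c : ι → Fin r → Finset V),
    0 < m → 0 < L → 0 < U.card → ERSys r m (L ^ r) U Γ c →
    L ^ r * U.card ≤ a * m * Γ.card → U.card ≤ b * L * m →
    ERCovers (fun S => S ⊆ U ∧ ERValid Γ c S)
      (fun D => D ⊆ U ∧ A * D.card + U.card ≤ A * U.card) ((U.card + 1) ^ (C * b)) := by
  classical
  induction r with
  | zero =>
    intro a ha
    refine ⟨1, 0, one_pos, ?_⟩
    intro V ι U m L b Γ c hm hL hU hs hden hb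
    refine ⟨∅, by simp, by simp, ?_⟩
    rintro S ⟨-, hV⟩
    have : Γ.Nonempty := by
      rw [Finset.nonempty_iff_ne_empty]
      rintro rfl
      simp at hden
      rw [hden] at hU; simp at hU
    obtain ⟨γ, hγ⟩ := this
    obtain ⟨j, -⟩ := hV γ hγ
    exact j.elim0
  | succ r ih =>
    intro a ha
    obtain ⟨A', C', hA', hih⟩ := ih (16 * (r + 1) * a) (by positivity)
    refine ⟨4 * a + A', a + C' * 2, by positivity, ?_⟩
    intro V ι U m L b Γ c hm hL hU hs hden hb
    set m' := (m + 1) / 2 with hm'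
    have hm'0 : 0 < m' := by omega
    have h2m' : 2 * m' ≤ m + 1 := by omega
    have hm2 : m ≤ 2 * m' := by omega
    have hLr : 0 < L ^ r := by positivity
    set A := 4 * a + A' with hA
    set Q : Finset V → Prop := fun D => D ⊆ U ∧ A * D.card + U.card ≤ A * U.card with hQ
    set u := U.card + 1 with hu
    -- the number of groups is bounded
    have hΓ : Γ.card ≤ b * L ^ (r + 2) := by
      have h1 : m * Γ.card ≤ L ^ (r + 1) * U.card := by
        calc m * Γ.card = ∑ γ ∈ Γ, m := by simp [mul_comm]
          _ ≤ ∑ γ ∈ Γ, ∑ j, (c γ j ∩ U).card := by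
            refine Finset.sum_le_sum fun γ hγ => ?_
            have := Finset.single_le_sum (f := fun j => (c γ j ∩ U).card) (fun _ _ => Nat.zero_le _)
                (Finset.mem_univ (0 : Fin (r + 1)))
            simpa [Finset.inter_eq_left.2 (hs.sub γ hγ _), hs.crd γ hγ] using this
          _ = ∑ v ∈ U, erDeg Γ c v := (erDeg_sum Γ c U hs.disj).symm
          _ ≤ ∑ v ∈ U, L ^ (r + 1) := Finset.sum_le_sum fun v _ => hs.deg v
          _ = _ := by simp [mul_comm]
      have h2 : m * Γ.card ≤ m * (b * L ^ (r + 2)) := by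
        calc m * Γ.card ≤ L ^ (r + 1) * (b * L * m) := h1.trans (Nat.mul_le_mul_left _ hb)
          _ = _ := by ring
      exact Nat.le_of_mul_le_mul_left h2 hm
    have halted : ∀ (Γ' : Finset ι) (c' : ι → Fin r → Finset V),
        ERState r m' (L ^ r) U Γ c Γ' c' → Γ.card ≤ 8 * (r + 1) * L * Γ'.card →
        ERCovers (fun S => S ⊆ U ∧ ERValid Γ c S ∧ ERValid Γ' c' S) Q (u ^ (C' * (2 * b))) := by
      intro Γ' c' hst hhalt
      refine (hih V ι U m' L (2 * b) Γ' c' hm'0 hL hU hst.sys ?_ ?_).mono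
        (fun S hS => ⟨hS.1, hS.2.2⟩) ?_ le_rfl
      · have : L * (L ^ r * U.card) ≤ L * (16 * (r + 1) * a * m' * Γ'.card) := by
          calc L * (L ^ r * U.card) = L ^ (r + 1) * U.card := by ring
            _ ≤ a * m * Γ.card := hden
            _ ≤ a * (2 * m') * (8 * (r + 1) * L * Γ'.card) := by gcongr
            _ = _ := by ring
        exact Nat.le_of_mul_le_mul_left this hL
      · calc U.card ≤ b * L * m := hb
          _ ≤ b * L * (2 * m') := by gcongr
          _ = _ := by ring
      · rintro D ⟨hD, h⟩
        refine ⟨hD, ?_⟩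
        have := Nat.mul_le_mul_left (4 * a) (Finset.card_le_card hD)
        rw [hA, add_mul, add_mul]; omega
    have loop : ∀ (k : ℕ) (Γ' : Finset ι) (c' : ι → Fin r → Finset V),
        ERState r m' (L ^ r) U Γ c Γ' c' →
        a * b * L ^ (r + 1) ≤ 4 * a * Γ'.card + k * L ^ (r + 1) →
        ERCovers (fun S => S ⊆ U ∧ ERValid Γ c S ∧ ERValid Γ' c' S) Q
          (u ^ k * u ^ (C' * (2 * b))) := by
      intro k
      induction k with
      | zero =>
        intro Γ' c' hst hk
        refine (halted Γ' c' hst ?_).mono (fun _ h => h) (fun _ h => h) (by simp)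
        have h1 : b * L ^ (r + 1) ≤ 4 * Γ'.card := by
          have : a * (b * L ^ (r + 1)) ≤ a * (4 * Γ'.card) := by nlinarith
          exact Nat.le_of_mul_le_mul_left this ha
        calc Γ.card ≤ b * L ^ (r + 2) := hΓ
          _ = L * (b * L ^ (r + 1)) := by ring
          _ ≤ L * (4 * Γ'.card) := by gcongr
          _ ≤ _ := by nlinarith [Nat.zero_le (r * L * Γ'.card), Nat.zero_le (L * Γ'.card)]
      | succ k ihk =>
        intro Γ' c' hst hk
        by_cases hhalt : Γ.card ≤ 8 * (r + 1) * L * Γ'.card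
        · refine (halted Γ' c' hst hhalt).mono (fun _ h => h) (fun _ h => h) ?_
          exact Nat.le_mul_of_pos_left _ (by positivity)
        push Not at hhalt
        set Γc := Γ.filter (fun γ => γ ∉ Γ' ∧
          ∀ j, 2 * (c γ j ∩ U.filter (fun v => L ^ r ≤ erDeg Γ' c' v)).card ≤ m) with hΓc
        have hcur : Γ.card ≤ 2 * Γc.card := er_cur hs hst (by omega) hm hL hhalt
        have hhigh := er_high (a := a) hs (Finset.filter_subset _ _) hcur hden (by positivity)
        set H := U.filter (fun x => L ^ (r + 1) ≤ 4 * a * erDeg Γc c x) with hH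
        have hHU : H ⊆ U := Finset.filter_subset _ _
        have c1 : ERCovers (fun S => S ⊆ U \ H) Q 1 := by
          refine ⟨{U \ H}, by simp, ?_, fun S hS => ⟨U \ H, by simp, hS⟩⟩
          intro D hD
          rw [Finset.mem_singleton] at hD
          subst hD
          refine ⟨Finset.sdiff_subset, ?_⟩
          have h1 := Finset.card_sdiff_add_card_eq_card hHU
          have h2 : U.card ≤ A * H.card := hhigh.trans (Nat.mul_le_mul_right _ (by omega))
          calc A * (U \ H).card + U.card ≤ A * (U \ H).card + A * H.card := by omega
            _ = A * U.card := by rw [← mul_add, h1]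
        have c2 : ERCovers (fun S => ∃ x ∈ H, x ∈ S ∧ S ⊆ U ∧ ERValid Γ c S ∧ ERValid Γ' c' S) Q
            (H.card * (u ^ k * u ^ (C' * (2 * b)))) := by
          refine ERCovers.biUnion H fun x hx => ?_
          obtain ⟨Γ'', c'', hst'', hcard, hval⟩ := er_pick hs hst h2m' x Γc
            (fun γ hγ => Finset.mem_filter.1 hγ)
          refine (ihk Γ'' c'' hst'' ?_).mono ?_ (fun _ h => h) le_rfl
          · rw [hcard]
            have := (Finset.mem_filter.1 hx).2
            have e1 : (k + 1) * L ^ (r + 1) = k * L ^ (r + 1) + L ^ (r + 1) := by ring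
            rw [mul_add]; omega
          · rintro S ⟨hxS, hSU, hV, hV'⟩
            exact ⟨hSU, hV, hval S hxS hV hV'⟩
        refine (c1.or c2).mono ?_ (fun _ h => h) ?_
        · rintro S ⟨hSU, hV, hV'⟩
          by_cases hex : ∃ x ∈ H, x ∈ S
          · obtain ⟨x, hx, hxS⟩ := hex
            exact Or.inr ⟨x, hx, hxS, hSU, hV, hV'⟩
          · left
            intro v hv
            exact Finset.mem_sdiff.2 ⟨hSU hv, fun h => hex ⟨v, h, hv⟩⟩
        · have h1 : 0 < u ^ k * u ^ (C' * (2 * b)) := by positivity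
          have h2 : H.card ≤ U.card := Finset.card_le_card hHU
          calc 1 + H.card * (u ^ k * u ^ (C' * (2 * b)))
              ≤ (u ^ k * u ^ (C' * (2 * b))) + U.card * (u ^ k * u ^ (C' * (2 * b))) := by gcongr; omega
            _ = _ := by rw [hu]; ring
    have hst0 : ERState r m' (L ^ r) U Γ c ∅ (fun _ _ => ∅) := by
      refine ⟨⟨by simp, by simp, by simp, by simp, by simp [erDeg]⟩, by simp, by simp⟩
    refine (loop (a * b) ∅ (fun _ _ => ∅) hst0 (by simp)).mono ?_ (fun _ h => h) ?_
    · rintro S ⟨h1, h2⟩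
      exact ⟨h1, h2, by simp [ERValid]⟩
    · rw [← pow_add]
      exact le_of_eq (by congr 1; ring)

end ERContainers2

section ERColour

open Classical in
lemma er_tail {I : Type} [Fintype I] (s : ℕ) (hs : 0 < s) (W : Finset I) (M : I → Fin s) :
    (((Finset.univ : Finset (I → Fin s)).filter
      (fun χ => 4 * s * (W.filter (fun i => χ i = M i)).card ≤ W.card)).card : ℝ)
      ≤ (s : ℝ) ^ (Fintype.card I) * Real.exp (-(W.card : ℝ) / (4 * s)) := by
  have hs' : (0 : ℝ) < s := by exact_mod_cast hs
  set w : I → Fin s → ℝ := fun i c => if i ∈ W ∧ c = M i then 1 / 2 else 1 with hw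
  have e1 : ∀ χ : I → Fin s, ∏ i, w i (χ i) = (1 / 2 : ℝ) ^ (W.filter (fun i => χ i = M i)).card := by
    intro χ
    simp only [hw]
    rw [Finset.prod_ite]
    simp only [Finset.prod_const, one_pow, mul_one]
    congr 2
    ext i; simp
  have e2 : ∏ i, ∑ c, w i c = ∑ χ : I → Fin s, ∏ i, w i (χ i) := by
    rw [Finset.prod_univ_sum]; simp
  have e3 : ∀ i, ∑ c, w i c = s * (if i ∈ W then (1 - 1 / (2 * s) : ℝ) else 1) := by
    intro i
    simp only [hw]
    by_cases hi : i ∈ W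
    · simp only [hi, true_and, if_true]
      rw [← Finset.add_sum_erase _ _ (Finset.mem_univ (M i))]
      rw [Finset.sum_congr rfl (g := fun _ => (1 : ℝ))]
      · rw [Finset.sum_const, Finset.card_erase_of_mem (Finset.mem_univ _)]
        simp only [Finset.card_univ, Fintype.card_fin, if_true, nsmul_eq_mul, mul_one]
        rw [Nat.cast_sub hs]; field_simp; push_cast; ring
      · intro c hc
        simp [Finset.ne_of_mem_erase hc]
    · simp [hi]
  have e4 : ∏ i, ∑ c, w i c = (s : ℝ) ^ (Fintype.card I) * (1 - 1 / (2 * s) : ℝ) ^ W.card := by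
    rw [Finset.prod_congr rfl (fun i _ => e3 i), Finset.prod_mul_distrib]
    congr 1
    · simp
    · rw [Finset.prod_ite_mem]; simp
  set B := (Finset.univ : Finset (I → Fin s)).filter
      (fun χ => 4 * s * (W.filter (fun i => χ i = M i)).card ≤ W.card) with hB
  have h1 : (B.card : ℝ) * Real.exp (-(W.card : ℝ) / (4 * s)) ≤
      (s : ℝ) ^ (Fintype.card I) * (1 - 1 / (2 * s) : ℝ) ^ W.card := by
    rw [← e4, e2]
    calc (B.card : ℝ) * Real.exp (-(W.card : ℝ) / (4 * s))
        = ∑ χ ∈ B, Real.exp (-(W.card : ℝ) / (4 * s)) := by simp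
      _ ≤ ∑ χ ∈ B, ∏ i, w i (χ i) := by
          refine Finset.sum_le_sum fun χ hχ => ?_
          rw [e1]
          have hx := (Finset.mem_filter.1 hχ).2
          set X := (W.filter (fun i => χ i = M i)).card
          have hx' : (4 * s * X : ℝ) ≤ W.card := by exact_mod_cast hx
          have h2 : Real.exp (-1) ≤ 1 / 2 := by
            have := Real.add_one_le_exp (1 : ℝ)
            rw [Real.exp_neg, one_div]
            exact inv_anti₀ (by norm_num) (by linarith)
          calc Real.exp (-(W.card : ℝ) / (4 * s)) ≤ Real.exp (X * (-1)) := by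
                apply Real.exp_le_exp.2
                rw [div_le_iff₀ (by positivity)]; nlinarith
            _ = Real.exp (-1) ^ X := by rw [Real.exp_nat_mul]
            _ ≤ (1 / 2) ^ X := by gcongr
      _ ≤ ∑ χ : I → Fin s, ∏ i, w i (χ i) := by
          refine Finset.sum_le_sum_of_subset_of_nonneg (Finset.subset_univ _) fun χ _ _ => ?_
          rw [e1]; positivity
  have h2 : (1 - 1 / (2 * s) : ℝ) ^ W.card ≤ Real.exp (-(W.card : ℝ) / (4 * s)) ^ 2 := by
    have h3 : (1 - 1 / (2 * s) : ℝ) ≤ Real.exp (-(1 / (2 * s))) := by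
      have := Real.add_one_le_exp (-(1 / (2 * s)) : ℝ)
      linarith
    have h0 : (0 : ℝ) ≤ 1 - 1 / (2 * s) := by
      have : (1 : ℝ) ≤ s := by exact_mod_cast hs
      rw [sub_nonneg, div_le_one (by positivity)]; linarith
    calc (1 - 1 / (2 * s) : ℝ) ^ W.card ≤ Real.exp (-(1 / (2 * s))) ^ W.card := by gcongr
      _ = Real.exp (W.card * (-(1 / (2 * s)))) := by rw [Real.exp_nat_mul]
      _ = Real.exp ((2 : ℕ) * (-(W.card : ℝ) / (4 * s))) := by
          congr 1; push_cast; field_simp; ring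
      _ = _ := by rw [Real.exp_nat_mul]
  set E := Real.exp (-(W.card : ℝ) / (4 * s)) with hE
  have hE0 : 0 < E := Real.exp_pos _
  have h5 : (B.card : ℝ) * E ≤ ((s : ℝ) ^ (Fintype.card I) * E) * E := by
    calc (B.card : ℝ) * E ≤ _ := h1
      _ ≤ (s : ℝ) ^ (Fintype.card I) * E ^ 2 := by gcongr
      _ = _ := by ring
  exact le_of_mul_le_mul_right h5 hE0

lemma er_sum_pow {V : Type} [Fintype V] [DecidableEq V] (x : ℝ) (hx : 0 ≤ x)
    (h : x * Fintype.card V ≤ 1 / 2) :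
    ∑ U ∈ (Finset.univ : Finset (Finset V)).erase ∅, x ^ U.card < 1 := by
  have h1 : ∑ U : Finset V, x ^ U.card = (x + 1) ^ (Fintype.card V) := by
    have := Fintype.sum_pow_mul_eq_add_pow V x 1
    simpa using this
  have h2 : (x + 1) ^ (Fintype.card V) < 2 := by
    calc (x + 1) ^ (Fintype.card V) ≤ Real.exp x ^ (Fintype.card V) := by
          gcongr; exact Real.add_one_le_exp x
      _ = Real.exp (Fintype.card V * x) := by rw [Real.exp_nat_mul]
      _ ≤ Real.exp (1 / 2) := Real.exp_le_exp.2 (by linarith)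
      _ < 2 := by
          have h3 : Real.exp (1 / 2) ^ 2 = Real.exp 1 := by
            rw [← Real.exp_nat_mul]; norm_num
          have h4 := Real.exp_one_lt_d9
          by_contra hcon
          push Not at hcon
          nlinarith
  have h3 := Finset.add_sum_erase (Finset.univ : Finset (Finset V)) (fun U => x ^ U.card) (Finset.mem_univ ∅)
  simp only [Finset.card_empty, pow_zero] at h3
  linarith

open Classical in
lemma er_colour {κ V F : Type} [Fintype κ] [Fintype V] [Fintype F] (lam : κ → V → F)
    (s : ℕ) (hs : 0 < s)
    (hx : Real.exp (-(Fintype.card κ : ℝ) / (8 * s)) * Fintype.card V ≤ 1 / 2) :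
    ∃ χ : κ × V → Fin s, ∀ U : Finset V, U.Nonempty → 8 * s ^ 2 * Fintype.card F ≤ U.card →
      ∀ M : κ × F → Fin s, Fintype.card κ * U.card <
        4 * s * (((Finset.univ : Finset κ) ×ˢ U).filter
          (fun i => χ i = M (i.1, lam i.1 i.2))).card := by
  have hs' : (0 : ℝ) < s := by exact_mod_cast hs
  by_contra hcon
  push Not at hcon
  set T := ((Finset.univ : Finset (Finset V)).erase ∅).filter
    (fun U => 8 * s ^ 2 * Fintype.card F ≤ U.card) with hT
  set B : Finset V → (κ × F → Fin s) → Finset (κ × V → Fin s) := fun U M =>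
    (Finset.univ : Finset (κ × V → Fin s)).filter
      (fun χ => 4 * s * ((((Finset.univ : Finset κ) ×ˢ U).filter
        (fun i => χ i = M (i.1, lam i.1 i.2))).card) ≤ ((Finset.univ : Finset κ) ×ˢ U).card) with hB
  have hcov : (Finset.univ : Finset (κ × V → Fin s)) ⊆ T.biUnion fun U => Finset.univ.biUnion (B U) := by
    intro χ _
    obtain ⟨U, hU, hUc, M, hM⟩ := hcon χ
    refine Finset.mem_biUnion.2 ⟨U, ?_, Finset.mem_biUnion.2 ⟨M, Finset.mem_univ _, ?_⟩⟩
    · simp [hT, hU.ne_empty, hUc]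
    · simp only [hB, Finset.mem_filter, Finset.mem_univ, true_and, Finset.card_product, Finset.card_univ]
      convert hM
  set x := Real.exp (-(Fintype.card κ : ℝ) / (8 * s)) with hxdef
  set N := (s : ℝ) ^ (Fintype.card (κ × V)) with hN
  have hN0 : 0 < N := by positivity
  have hBc : ∀ U ∈ T, ∀ M, ((B U M).card : ℝ) ≤ N * Real.exp (-((Fintype.card κ * U.card : ℕ) : ℝ) / (4 * s)) := by
    intro U _ M
    have := er_tail s hs ((Finset.univ : Finset κ) ×ˢ U) (fun i => M (i.1, lam i.1 i.2))
    rw [Finset.card_product, Finset.card_univ] at this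
    simp only [hB, Finset.card_product, Finset.card_univ]
    convert this
  have hU1 : ∀ U ∈ T, ((Finset.univ.biUnion (B U)).card : ℝ) ≤ N * x ^ U.card := by
    intro U hU
    have hUc : 8 * s ^ 2 * Fintype.card F ≤ U.card := (Finset.mem_filter.1 hU).2
    have hUc' : (8 * s ^ 2 * Fintype.card F : ℝ) ≤ U.card := by exact_mod_cast hUc
    have hsexp : (s : ℝ) ≤ Real.exp s := by
      have := Real.add_one_le_exp (s : ℝ); linarith
    calc ((Finset.univ.biUnion (B U)).card : ℝ) ≤ ∑ M, ((B U M).card : ℝ) := by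
          exact_mod_cast Finset.card_biUnion_le
      _ ≤ ∑ M : κ × F → Fin s, N * Real.exp (-((Fintype.card κ * U.card : ℕ) : ℝ) / (4 * s)) :=
          Finset.sum_le_sum fun M _ => hBc U hU M
      _ = N * ((s : ℝ) ^ (Fintype.card κ * Fintype.card F) *
            Real.exp (-((Fintype.card κ * U.card : ℕ) : ℝ) / (4 * s))) := by
          simp; ring
      _ ≤ N * (Real.exp s ^ (Fintype.card κ * Fintype.card F) *
            Real.exp (-((Fintype.card κ * U.card : ℕ) : ℝ) / (4 * s))) := by gcongr
      _ = N * Real.exp ((Fintype.card κ * Fintype.card F : ℕ) * s +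
            -((Fintype.card κ * U.card : ℕ) : ℝ) / (4 * s)) := by
          rw [Real.exp_add, Real.exp_nat_mul]
      _ ≤ N * Real.exp (U.card * (-(Fintype.card κ : ℝ) / (8 * s))) := by
          gcongr
          push_cast
          have : (Fintype.card κ : ℝ) * Fintype.card F * s ≤ Fintype.card κ * (U.card / (8 * s)) := by
            rw [mul_assoc]
            gcongr
            rw [le_div_iff₀ (by positivity)]
            nlinarith
          calc _ ≤ (Fintype.card κ : ℝ) * (U.card / (8 * s)) + -(Fintype.card κ * U.card) / (4 * s) := by
                gcongr
            _ = _ := by field_simp; ring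
      _ = N * x ^ U.card := by rw [Real.exp_nat_mul]
  have htot : (N : ℝ) ≤ ∑ U ∈ T, N * x ^ U.card := by
    calc N = ((Finset.univ : Finset (κ × V → Fin s)).card : ℝ) := by
          rw [hN]; simp
      _ ≤ ((T.biUnion fun U => Finset.univ.biUnion (B U)).card : ℝ) := by
          exact_mod_cast Finset.card_le_card hcov
      _ ≤ ∑ U ∈ T, ((Finset.univ.biUnion (B U)).card : ℝ) := by
          exact_mod_cast Finset.card_biUnion_le
      _ ≤ _ := Finset.sum_le_sum hU1
  have hlt : ∑ U ∈ T, N * x ^ U.card < N := by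
    rw [← Finset.mul_sum]
    have h1 : ∑ U ∈ T, x ^ U.card < 1 :=
      lt_of_le_of_lt (Finset.sum_le_sum_of_subset_of_nonneg (Finset.filter_subset _ _)
        (fun U _ _ => by positivity)) (er_sum_pow x (Real.exp_pos _).le hx)
    nlinarith
  linarith

end ERColour

section ERChunk

lemma er_chunk_aux {V : Type} (m : ℕ) : ∀ (k : ℕ) (X : Finset V), k * m ≤ X.card →
    ∃ f : ℕ → Finset V, (∀ i, f i ⊆ X) ∧ (∀ i, i < k → (f i).card = m) ∧
      ∀ i j, i < k → j < k → i ≠ j → Disjoint (f i) (f j) := by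
  classical
  intro k
  induction k with
  | zero => intro X _; exact ⟨fun _ => ∅, by simp, by simp, by simp⟩
  | succ k ih =>
    intro X hX
    have hX' : k * m + m ≤ X.card := by rw [Nat.succ_mul] at hX; exact hX
    obtain ⟨Z, hZX, hZ⟩ := Finset.exists_subset_card_eq (s := X) (n := m) (by omega)
    obtain ⟨f, h1, h2, h3⟩ := ih (X \ Z) (by rw [Finset.card_sdiff_of_subset hZX]; omega)
    have hd : ∀ i, Disjoint Z (f i) := fun i =>
      Finset.disjoint_of_subset_right (h1 i) Finset.disjoint_sdiff
    refine ⟨fun i => if i = k then Z else f i, ?_, ?_, ?_⟩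
    · intro i
      by_cases h : i = k
      · simp [h, hZX]
      · simp only [h, if_false]; exact (h1 i).trans Finset.sdiff_subset
    · intro i hi
      by_cases h : i = k
      · simp [h, hZ]
      · simp only [h, if_false]; exact h2 i (by omega)
    · intro i j hi hj hij
      by_cases h : i = k
      · have hj' : j ≠ k := fun e => hij (h.trans e.symm)
        simp only [h, hj', if_true, if_false]; exact hd j
      · by_cases h' : j = k
        · simp only [h, h', if_true, if_false]; exact (hd i).symm
        · simp only [h, h', if_false]; exact h3 i j (by omega) (by omega) hij

/-- The line-colouring graph. -/
def erGraph {κ V F : Type} {s : ℕ} (lam : κ → V → F) (χ : κ × V → Fin s) : SimpleGraph V where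
  Adj v w := ∃ y, lam y v = lam y w ∧ χ (y, v) ≠ χ (y, w)
  symm := ⟨fun _ _ ⟨y, h1, h2⟩ => ⟨y, h1.symm, h2.symm⟩⟩
  loopless := ⟨fun _ ⟨_, _, h2⟩ => h2 rfl⟩

end ERChunk

section ERSystem

/-- `S` contains no clique of size `s`, phrased with maps from `Fin s`. -/
def ERFree {V : Type} (G : SimpleGraph V) (s : ℕ) (S : Finset V) : Prop :=
  ∀ g : Fin s → V, (∀ i, g i ∈ S) → ∃ i j, i ≠ j ∧ ¬ G.Adj (g i) (g j)

open Classical in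
lemma er_system {κ V F : Type} [Fintype κ] [Fintype V] [Fintype F] (lam : κ → V → F)
    (hnet : ∀ v w, v ≠ w → ∀ y y', lam y v = lam y w → lam y' v = lam y' w → y = y')
    (s : ℕ) (hs : 0 < s) (hF : 0 < Fintype.card F) (χ : κ × V → Fin s) (U : Finset V)
    (hUc : 8 * s ^ 2 * Fintype.card F ≤ U.card)
    (hχ : ∀ M : κ × F → Fin s, Fintype.card κ * U.card <
        4 * s * (((Finset.univ : Finset κ) ×ˢ U).filter
          (fun i => χ i = M (i.1, lam i.1 i.2))).card) :
    ∃ (m : ℕ) (Γ : Finset (Σ _ : κ × F, ℕ)) (c : (Σ _ : κ × F, ℕ) → Fin s → Finset V),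
      0 < m ∧ ERSys s m (Fintype.card κ) U Γ c ∧ Fintype.card κ * U.card ≤ (8 * s) * m * Γ.card ∧
      U.card ≤ 16 * s * Fintype.card F * m ∧
      ∀ S : Finset V, ERFree (erGraph lam χ) s S → ERValid Γ c S := by
  haveI : Nonempty (Fin s) := ⟨⟨0, hs⟩⟩
  set cl : κ × F → Fin s → Finset V := fun p j => U.filter (fun v => lam p.1 v = p.2 ∧ χ (p.1, v) = j)
    with hcl
  have hmin : ∀ p : κ × F, ∃ j0 : Fin s, ∀ j, (cl p j0).card ≤ (cl p j).card := by
    intro p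
    obtain ⟨j0, _, h⟩ := Finset.exists_min_image (Finset.univ : Finset (Fin s))
      (fun j => (cl p j).card) Finset.univ_nonempty
    exact ⟨j0, fun j => h j (Finset.mem_univ _)⟩
  choose M hM using hmin
  set m := U.card / (8 * s * Fintype.card F) with hm
  have hpos : 0 < 8 * s * Fintype.card F := by positivity
  have hle : 8 * s * Fintype.card F ≤ U.card := by
    refine le_trans ?_ hUc
    gcongr
    nlinarith
  have hm0 : 0 < m := Nat.div_pos hle hpos
  have hm1 : 8 * s * Fintype.card F * m ≤ U.card := Nat.mul_div_le _ _
  have hm2 : U.card < 8 * s * Fintype.card F * (m + 1) := Nat.lt_mul_div_succ _ hpos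
  set ν : κ × F → ℕ := fun p => (cl p (M p)).card with hν
  have hch : ∀ p j, ∃ f : ℕ → Finset V, (∀ i, f i ⊆ cl p j) ∧
      (∀ i, i < ν p / m → (f i).card = m) ∧
      ∀ i i', i < ν p / m → i' < ν p / m → i ≠ i' → Disjoint (f i) (f i') := by
    intro p j
    exact er_chunk_aux m (ν p / m) (cl p j) ((Nat.div_mul_le_self _ _).trans (hM p j))
  choose f hf1 hf2 hf3 using hch
  set Γ : Finset (Σ _ : κ × F, ℕ) :=
    (Finset.univ : Finset (κ × F)).sigma (fun p => Finset.range (ν p / m)) with hΓ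
  set c : (Σ _ : κ × F, ℕ) → Fin s → Finset V := fun γ j => f γ.1 j γ.2 with hc
  have hmem : ∀ γ j v, v ∈ c γ j → v ∈ U ∧ lam γ.1.1 v = γ.1.2 ∧ χ (γ.1.1, v) = j := by
    intro γ j v hv
    have := hf1 γ.1 j γ.2 hv
    simpa [hcl] using this
  have hlt : ∀ γ ∈ Γ, γ.2 < ν γ.1 / m := by
    intro γ hγ
    simpa [hΓ] using hγ
  have hkey : ∀ γ ∈ Γ, ∀ γ' ∈ Γ, ∀ v, γ.1.1 = γ'.1.1 → (∃ j, v ∈ c γ j) → (∃ j, v ∈ c γ' j) → γ = γ' := by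
    rintro ⟨⟨y, l⟩, i⟩ hγ ⟨⟨y', l'⟩, i'⟩ hγ' v hy ⟨j, hj⟩ ⟨j', hj'⟩
    simp only at hy
    subst hy
    obtain ⟨_, h2, h3⟩ := hmem _ _ _ hj
    obtain ⟨_, h2', h3'⟩ := hmem _ _ _ hj'
    simp only at h2 h2' h3 h3'
    subst h2; subst h2'; subst h3; subst h3'
    have hi := hlt _ hγ
    have hi' := hlt _ hγ'
    by_contra hne
    have hii : i ≠ i' := by
      rintro rfl; exact hne rfl
    exact Finset.disjoint_left.1 (hf3 _ _ i i' hi hi' hii) hj hj'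
  refine ⟨m, Γ, c, hm0, ⟨?_, ?_, ?_, ?_, ?_⟩, ?_, ?_, ?_⟩
  · intro γ _ j v hv; exact (hmem γ j v hv).1
  · intro γ hγ j; exact hf2 _ _ _ (hlt γ hγ)
  · intro γ _ i j hij
    rw [Finset.disjoint_left]
    intro v hv hv'
    exact hij ((hmem _ _ _ hv).2.2.symm.trans (hmem _ _ _ hv').2.2)
  · intro γ hγ γ' hγ' v w hvw hv hw hv' hw'
    refine hkey γ hγ γ' hγ' v ?_ hv hv'
    obtain ⟨_, h1⟩ := hv
    obtain ⟨_, h2⟩ := hw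
    obtain ⟨_, h3⟩ := hv'
    obtain ⟨_, h4⟩ := hw'
    exact hnet v w hvw _ _ ((hmem _ _ _ h1).2.1.trans (hmem _ _ _ h2).2.1.symm)
      ((hmem _ _ _ h3).2.1.trans (hmem _ _ _ h4).2.1.symm)
  · intro v
    unfold erDeg
    rw [← Finset.card_univ (α := κ)]
    refine Finset.card_le_card_of_injOn (fun γ => γ.1.1) (fun _ _ => Finset.mem_coe.2 (Finset.mem_univ _)) ?_
    intro γ hγ γ' hγ' h
    have h1 := Finset.mem_filter.1 (Finset.mem_coe.1 hγ)
    have h2 := Finset.mem_filter.1 (Finset.mem_coe.1 hγ')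
    exact hkey γ h1.1 γ' h2.1 v h h1.2 h2.2
  · have h1 := hχ M
    have h2 : (((Finset.univ : Finset κ) ×ˢ U).filter
          (fun i => χ i = M (i.1, lam i.1 i.2))).card = ∑ p : κ × F, ν p := by
      rw [Finset.card_eq_sum_card_fiberwise (f := fun i => (i.1, lam i.1 i.2)) (t := Finset.univ)
        (fun _ _ => Finset.mem_coe.2 (Finset.mem_univ _))]
      refine Finset.sum_congr rfl ?_
      rintro ⟨y, l⟩ _
      simp only [hν]
      refine Finset.card_bij' (fun i _ => i.2) (fun v _ => (y, v)) ?_ ?_ ?_ ?_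
      · rintro ⟨y', v⟩ h
        simp only [Finset.mem_filter, Finset.mem_product, Finset.mem_univ, true_and, Prod.mk.injEq] at h
        obtain ⟨⟨h1, h2⟩, h3, h4⟩ := h
        subst h3; subst h4
        simp [hcl, h1, h2]
      · intro v h
        simp only [hcl, Finset.mem_filter] at h
        simp [h.1, h.2.1, h.2.2]
      · rintro ⟨y', v⟩ h
        simp only [Finset.mem_filter, Finset.mem_product, Finset.mem_univ, true_and, Prod.mk.injEq] at h
        obtain ⟨⟨h1, h2⟩, h3, h4⟩ := h
        simp [h3]
      · intro v h; rfl
    have h3 : Γ.card = ∑ p : κ × F, ν p / m := by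
      rw [hΓ, Finset.card_sigma]; simp
    have h4 : ∑ p : κ × F, ν p ≤ m * Γ.card + Fintype.card κ * Fintype.card F * m := by
      rw [h3, Finset.mul_sum]
      calc ∑ p : κ × F, ν p ≤ ∑ p : κ × F, (m * (ν p / m) + m) := by
            refine Finset.sum_le_sum fun p _ => ?_
            have := Nat.lt_mul_div_succ (ν p) hm0
            rw [Nat.mul_succ] at this
            exact this.le
        _ = _ := by
            rw [Finset.sum_add_distrib]; simp
    rw [h2] at h1
    have h5 : 4 * s * ∑ p : κ × F, ν p ≤ 4 * s * (m * Γ.card + Fintype.card κ * Fintype.card F * m) :=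
      Nat.mul_le_mul_left _ h4
    have h6 : Fintype.card κ * (8 * s * Fintype.card F * m) ≤ Fintype.card κ * U.card :=
      Nat.mul_le_mul_left _ hm1
    nlinarith
  · calc U.card ≤ 8 * s * Fintype.card F * (m + 1) := hm2.le
      _ ≤ 8 * s * Fintype.card F * (m + m) := by gcongr; omega
      _ = _ := by ring
  · intro S hS γ hγ
    by_contra hcon
    push Not at hcon
    have : ∀ j, ∃ v, v ∈ S ∧ v ∈ c γ j := fun j => Finset.not_disjoint_iff.1 (hcon j)
    choose g hg1 hg2 using this
    obtain ⟨i, j, hij, hadj⟩ := hS g hg1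
    apply hadj
    obtain ⟨_, h2, h3⟩ := hmem _ _ _ (hg2 i)
    obtain ⟨_, h2', h3'⟩ := hmem _ _ _ (hg2 j)
    exact ⟨γ.1.1, h2.trans h2'.symm, by rw [h3, h3']; exact hij⟩

end ERSystem

section ERIterate

open Classical in
lemma er_iterate (s : ℕ) (hs : 0 < s) : ∃ A C : ℕ, 0 < A ∧ ∀ (κ V F : Type) [Fintype κ] [Fintype V]
    [Fintype F] (lam : κ → V → F)
    (_ : ∀ v w, v ≠ w → ∀ y y', lam y v = lam y w → lam y' v = lam y' w → y = y')
    (_ : 0 < Fintype.card F) (χ : κ × V → Fin s)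
    (_ : ∀ U : Finset V, U.Nonempty → 8 * s ^ 2 * Fintype.card F ≤ U.card →
      ∀ M : κ × F → Fin s, Fintype.card κ * U.card <
        4 * s * (((Finset.univ : Finset κ) ×ˢ U).filter
          (fun i => χ i = M (i.1, lam i.1 i.2))).card) (L b : ℕ) (_ : 0 < L)
    (_ : Fintype.card κ = L ^ s) (_ : 16 * s * Fintype.card F ≤ b * L),
    ∀ k : ℕ, ERCovers (fun S : Finset V => ERFree (erGraph lam χ) s S)
      (fun D => D.card < 8 * s ^ 2 * Fintype.card F ∨
        A ^ k * D.card ≤ (A - 1) ^ k * Fintype.card V)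
      (((Fintype.card V + 1) ^ (C * b)) ^ k) := by
  obtain ⟨A, C, hA, hcont⟩ := er_container s (8 * s) (by omega)
  refine ⟨A, C, hA, ?_⟩
  intro κ V F _ _ _ lam hnet hF χ hχ L b hL hκ hb k
  induction k with
  | zero =>
    refine ⟨{Finset.univ}, by simp, ?_, ?_⟩
    · intro D hD; right; rw [Finset.mem_singleton.1 hD]; simp
    · intro S _; exact ⟨Finset.univ, by simp, Finset.subset_univ _⟩
  | succ k ih =>
    obtain ⟨𝒟, h1, h2, h3⟩ := ih
    have hstep : ∀ D ∈ 𝒟, ERCovers (fun S : Finset V => S ⊆ D ∧ ERFree (erGraph lam χ) s S)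
        (fun D => D.card < 8 * s ^ 2 * Fintype.card F ∨
        A ^ (k + 1) * D.card ≤ (A - 1) ^ (k + 1) * Fintype.card V)
        ((Fintype.card V + 1) ^ (C * b)) := by
      intro D hD
      by_cases hsm : D.card < 8 * s ^ 2 * Fintype.card F
      · refine ⟨{D}, ?_, ?_, ?_⟩
        · rw [Finset.card_singleton]; exact Nat.one_le_pow _ _ (by omega)
        · intro D' hD'; left; rwa [Finset.mem_singleton.1 hD']
        · intro S hS; exact ⟨D, by simp, hS.1⟩
      · push Not at hsm
        have hD0 : 0 < D.card := lt_of_lt_of_le (by positivity) hsm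
        obtain ⟨m, Γ, c, hm, hsys, hd, hUm, hval⟩ := er_system lam hnet s hs hF χ D hsm
          (fun M => hχ D (Finset.card_pos.1 hD0) hsm M)
        rw [hκ] at hsys hd
        have := hcont V _ D m L b Γ c hm hL hD0 hsys hd (by
          calc D.card ≤ _ := hUm
            _ ≤ b * L * m := by gcongr)
        refine this.mono ?_ ?_ ?_
        · intro S hS; exact ⟨hS.1, hval S hS.2⟩
        · intro D' hD'
          right
          have hk : A ^ k * D.card ≤ (A - 1) ^ k * Fintype.card V := by
            rcases h2 D hD with h | h
            · omega
            · exact h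
          obtain ⟨B, rfl⟩ : ∃ B, A = B + 1 := ⟨A - 1, by omega⟩
          simp only [Nat.add_sub_cancel] at hk ⊢
          have h4 : (B + 1) * D'.card ≤ B * D.card := by
            have := hD'.2; nlinarith
          calc (B + 1) ^ (k + 1) * D'.card = (B + 1) ^ k * ((B + 1) * D'.card) := by ring
            _ ≤ (B + 1) ^ k * (B * D.card) := Nat.mul_le_mul_left _ h4
            _ = B * ((B + 1) ^ k * D.card) := by ring
            _ ≤ B * (B ^ k * Fintype.card V) := Nat.mul_le_mul_left _ hk
            _ = _ := by ring
        · exact Nat.pow_le_pow_left (by have := Finset.card_le_univ D; omega) _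
    refine (ERCovers.biUnion 𝒟 hstep).mono ?_ (fun _ h => h) ?_
    · intro S hS
      obtain ⟨D, hD, hSD⟩ := h3 S hS
      exact ⟨D, hD, hSD, hS⟩
    · rw [pow_succ]; exact Nat.mul_le_mul_right _ h1

end ERIterate

section ERSlopes

/-- Six slopes of a generic planar complete quadrilateral. -/
def ERBad {K : Type} [Field K] (ab ac ad bc bd cd : K) : Prop :=
  (ab - bc) * (ac - cd) * (ad - bd) = (ac - bc) * (ad - cd) * (ab - bd) ∧
  ab ≠ ac ∧ ab ≠ ad ∧ ab ≠ bc ∧ ab ≠ bd ∧ ac ≠ ad ∧ ac ≠ bc ∧ ac ≠ cd ∧ ad ≠ bd ∧ ad ≠ cd ∧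
  bc ≠ bd ∧ bc ≠ cd ∧ bd ≠ cd

/-- No generic quadrilateral has all its slopes in `Y`. -/
def ERGood {K : Type} [Field K] (Y : Finset K) : Prop :=
  ∀ ab ∈ Y, ∀ ac ∈ Y, ∀ ad ∈ Y, ∀ bc ∈ Y, ∀ bd ∈ Y, ∀ cd ∈ Y, ¬ ERBad ab ac ad bc bd cd

lemma ERBad.swapbc {K : Type} [Field K] {ab ac ad bc bd cd : K} (h : ERBad ab ac ad bc bd cd) :
    ERBad ac ab ad bc cd bd := by
  obtain ⟨h0, h⟩ := h
  refine ⟨by linear_combination -h0, ?_⟩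
  tauto

lemma ERBad.swapbd {K : Type} [Field K] {ab ac ad bc bd cd : K} (h : ERBad ab ac ad bc bd cd) :
    ERBad ad ac ab cd bd bc := by
  obtain ⟨h0, h⟩ := h
  refine ⟨by linear_combination -h0, ?_⟩
  tauto

lemma ERBad.swap2 {K : Type} [Field K] {ab ac ad bc bd cd : K} (h : ERBad ab ac ad bc bd cd) :
    ERBad cd ac bc ad bd ab := by
  obtain ⟨h0, h⟩ := h
  refine ⟨by linear_combination h0, ?_⟩
  tauto

open Classical in
lemma er_roots {K : Type} [Field K] [Fintype K] (α β γ : K) (h : ¬ (α = 0 ∧ β = 0 ∧ γ = 0)) :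
    ((Finset.univ : Finset K).filter (fun y => α + β * y + γ * y ^ 2 = 0)).card ≤ 2 := by
  set P : Polynomial K := Polynomial.C γ * Polynomial.X ^ 2 + Polynomial.C β * Polynomial.X + Polynomial.C α
    with hP
  have hP0 : P ≠ 0 := by
    intro h0
    apply h
    refine ⟨?_, ?_, ?_⟩
    · have := congrArg (fun Q => Polynomial.coeff Q 0) h0
      simpa [hP] using this
    · have := congrArg (fun Q => Polynomial.coeff Q 1) h0
      simpa [hP, Polynomial.coeff_C, Polynomial.coeff_X_pow] using this
    · have := congrArg (fun Q => Polynomial.coeff Q 2) h0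
      simpa [hP, Polynomial.coeff_C, Polynomial.coeff_X] using this
  have h1 : (Finset.univ : Finset K).filter (fun y => α + β * y + γ * y ^ 2 = 0) ⊆ P.roots.toFinset := by
    intro y hy
    have := (Finset.mem_filter.1 hy).2
    rw [Multiset.mem_toFinset, Polynomial.mem_roots hP0, Polynomial.IsRoot]
    simp only [hP, Polynomial.eval_add, Polynomial.eval_mul, Polynomial.eval_C, Polynomial.eval_pow,
      Polynomial.eval_X]
    linear_combination this
  calc _ ≤ P.roots.toFinset.card := Finset.card_le_card h1
    _ ≤ Multiset.card P.roots := Multiset.toFinset_card_le _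
    _ ≤ P.natDegree := Polynomial.card_roots' P
    _ ≤ 2 := Polynomial.natDegree_quadratic_le

open Classical in
lemma er_bad1 {K : Type} [Field K] [Fintype K] (ac ad bc bd cd : K) :
    ((Finset.univ : Finset K).filter (fun y => ERBad y ac ad bc bd cd)).card ≤ 2 := by
  by_cases hd : ac ≠ bc ∧ ad ≠ cd ∧ bc ≠ bd
  · refine le_trans (Finset.card_le_card ?_) (er_roots
      (-bc * (ac - cd) * (ad - bd) + (ac - bc) * (ad - cd) * bd)
      ((ac - cd) * (ad - bd) - (ac - bc) * (ad - cd)) 0 ?_)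
    · intro y hy
      have := (Finset.mem_filter.1 hy).2.1
      simp only [Finset.mem_filter, Finset.mem_univ, true_and]
      linear_combination this
    · rintro ⟨h1, h2, -⟩
      have : (ac - bc) * (ad - cd) * (bc - bd) = 0 := by linear_combination -h1 - bc * h2
      obtain ⟨h3, h4, h5⟩ := hd
      simp [sub_eq_zero, h3, h4, h5] at this
  · have : (Finset.univ : Finset K).filter (fun y => ERBad y ac ad bc bd cd) = ∅ := by
      refine Finset.filter_eq_empty_iff.2 ?_
      rintro y _ ⟨_, h⟩
      apply hd; tauto
    rw [this]; simp

open Classical in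
lemma er_bad2 {K : Type} [Field K] [Fintype K] (h2 : (2 : K) ≠ 0) (ac ad bc bd : K) :
    ((Finset.univ : Finset K).filter (fun y => ERBad y ac ad bc bd y)).card ≤ 2 := by
  by_cases hd : ac ≠ ad ∧ ac ≠ bc ∧ ad ≠ bd ∧ bc ≠ bd
  · refine le_trans (Finset.card_le_card ?_) (er_roots
      (-(bc - ac) * ad * bd + bc * ac * (bd - ad))
      ((bc - ac) * (ad + bd) - (bc + ac) * (bd - ad)) (-(bc - ac) + (bd - ad)) ?_)
    · intro y hy
      have := (Finset.mem_filter.1 hy).2.1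
      simp only [Finset.mem_filter, Finset.mem_univ, true_and]
      linear_combination this
    · rintro ⟨e1, e2, e3⟩
      obtain ⟨n1, n2, n3, n4⟩ := hd
      have f1 : (bc - ad) * (ad - ac) * (bd - ad) = 0 := by
        linear_combination -e1 - ad * e2 - ad ^ 2 * e3
      have f2 : (bc - bd) * (bd - ac) * (bd - ad) = 0 := by
        linear_combination -e1 - bd * e2 - bd ^ 2 * e3
      simp only [mul_eq_zero, sub_eq_zero, n1.symm, n3.symm, n4, or_false, false_or] at f1 f2
      subst f1; subst f2
      have : 2 * (bc - bd) = 0 := by linear_combination -e3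
      simp [sub_eq_zero, h2, n4] at this
  · have : (Finset.univ : Finset K).filter (fun y => ERBad y ac ad bc bd y) = ∅ := by
      refine Finset.filter_eq_empty_iff.2 ?_
      rintro y _ ⟨_, h⟩
      apply hd; tauto
    rw [this]; simp

open Classical in
lemma er_extend {K : Type} [Field K] [Fintype K] (h2 : (2 : K) ≠ 0) (Y : Finset K) (hY : ERGood Y)
    (hc : 5 * Y.card ^ 5 < Fintype.card K) : ∃ y, y ∉ Y ∧ ERGood (insert y Y) := by
  set E1 : Finset K := (Y ×ˢ Y ×ˢ Y ×ˢ Y ×ˢ Y).biUnion (fun t => (Finset.univ : Finset K).filter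
    (fun y => ERBad y t.1 t.2.1 t.2.2.1 t.2.2.2.1 t.2.2.2.2)) with hE1
  set E2 : Finset K := (Y ×ˢ Y ×ˢ Y ×ˢ Y).biUnion (fun t => (Finset.univ : Finset K).filter
    (fun y => ERBad y t.1 t.2.1 t.2.2.1 t.2.2.2 y)) with hE2
  have c1 : E1.card ≤ Y.card ^ 5 * 2 := by
    refine (Finset.card_biUnion_le_card_mul _ _ 2 (fun t _ => er_bad1 _ _ _ _ _)).trans ?_
    simp only [Finset.card_product]; apply le_of_eq; ring
  have c2 : E2.card ≤ Y.card ^ 4 * 2 := by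
    refine (Finset.card_biUnion_le_card_mul _ _ 2 (fun t _ => er_bad2 h2 _ _ _ _)).trans ?_
    simp only [Finset.card_product]; apply le_of_eq; ring
  have c3 : (Y ∪ E1 ∪ E2).card < Fintype.card K := by
    have h3 := Finset.card_union_le (Y ∪ E1) E2
    have h4 := Finset.card_union_le Y E1
    have h5 : Y.card ^ 4 ≤ Y.card ^ 5 := by
      rcases Nat.eq_zero_or_pos Y.card with h | h
      · simp [h]
      · exact Nat.pow_le_pow_right h (by norm_num)
    have h6 : Y.card ≤ Y.card ^ 5 := Nat.le_self_pow (by norm_num) _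
    omega
  obtain ⟨y, hy⟩ : ∃ y, y ∉ Y ∪ E1 ∪ E2 := by
    by_contra hcon
    push Not at hcon
    have : Y ∪ E1 ∪ E2 = Finset.univ := Finset.eq_univ_of_forall hcon
    rw [this, Finset.card_univ] at c3
    exact lt_irrefl _ c3
  simp only [Finset.mem_union, not_or] at hy
  obtain ⟨⟨hyY, hyE1⟩, hyE2⟩ := hy
  have k1 : ∀ ac ∈ Y, ∀ ad ∈ Y, ∀ bc ∈ Y, ∀ bd ∈ Y, ∀ cd ∈ insert y Y, ¬ ERBad y ac ad bc bd cd := by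
    intro ac hac ad had bc hbc bd hbd cd hcd hbad
    rcases Finset.mem_insert.1 hcd with rfl | hcd
    · apply hyE2
      exact Finset.mem_biUnion.2 ⟨(ac, ad, bc, bd), by simp [*], by simp [hbad]⟩
    · apply hyE1
      exact Finset.mem_biUnion.2 ⟨(ac, ad, bc, bd, cd), by simp [*], by simp [hbad]⟩
  have k2 : ∀ ac ∈ insert y Y, ∀ ad ∈ insert y Y, ∀ bc ∈ insert y Y, ∀ bd ∈ insert y Y,
      ∀ cd ∈ insert y Y, ¬ ERBad y ac ad bc bd cd := by
    intro ac hac ad had bc hbc bd hbd cd hcd hbad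
    obtain ⟨h0, n1, n2, n3, n4, _⟩ := id hbad
    exact k1 ac (Finset.mem_of_mem_insert_of_ne hac n1.symm) ad
      (Finset.mem_of_mem_insert_of_ne had n2.symm) bc (Finset.mem_of_mem_insert_of_ne hbc n3.symm)
      bd (Finset.mem_of_mem_insert_of_ne hbd n4.symm) cd hcd hbad
  refine ⟨y, hyY, ?_⟩
  intro ab hab ac hac ad had bc hbc bd hbd cd hcd hbad
  by_cases e1 : ab = y
  · subst e1; exact k2 _ hac _ had _ hbc _ hbd _ hcd hbad
  by_cases e2 : cd = y
  · subst e2; exact k2 _ hac _ hbc _ had _ hbd _ hab hbad.swap2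
  by_cases e3 : ac = y
  · subst e3; exact k2 _ hab _ had _ hbc _ hcd _ hbd hbad.swapbc
  by_cases e4 : bd = y
  · subst e4; exact k2 _ hab _ hbc _ had _ hcd _ hac hbad.swapbc.swap2
  by_cases e5 : ad = y
  · subst e5; exact k2 _ hac _ hab _ hcd _ hbd _ hbc hbad.swapbd
  by_cases e6 : bc = y
  · subst e6; exact k2 _ hac _ hcd _ hab _ hbd _ had hbad.swapbd.swap2
  exact hY _ (Finset.mem_of_mem_insert_of_ne hab e1) _ (Finset.mem_of_mem_insert_of_ne hac e3)
    _ (Finset.mem_of_mem_insert_of_ne had e5) _ (Finset.mem_of_mem_insert_of_ne hbc e6)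
    _ (Finset.mem_of_mem_insert_of_ne hbd e4) _ (Finset.mem_of_mem_insert_of_ne hcd e2) hbad

lemma er_slopes {K : Type} [Field K] [Fintype K] (h2 : (2 : K) ≠ 0) (R : ℕ)
    (hc : 5 * R ^ 5 < Fintype.card K) : ∃ Y : Finset K, Y.card = R ∧ ERGood Y := by
  classical
  induction R with
  | zero => exact ⟨∅, by simp, by intro ab hab; simp at hab⟩
  | succ R ih =>
    have h3 : R ^ 5 ≤ (R + 1) ^ 5 := Nat.pow_le_pow_left (by omega) _
    obtain ⟨Y, hYc, hY⟩ := ih (by omega)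
    obtain ⟨y, hy, hg⟩ := er_extend h2 Y hY (by rw [hYc]; omega)
    exact ⟨insert y Y, by rw [Finset.card_insert_of_notMem hy, hYc], hg⟩

end ERSlopes

section ERPlane

/-- Intercept of the line of slope `y` through `v`. -/
def erLam {K : Type} [Field K] (Y : Finset K) (y : {y // y ∈ Y}) (v : K × K) : K := v.2 - y.1 * v.1

lemma er_net {K : Type} [Field K] {v w : K × K} (h : v ≠ w) {y y' : K}
    (h1 : v.2 - y * v.1 = w.2 - y * w.1) (h2 : v.2 - y' * v.1 = w.2 - y' * w.1) : y = y' := by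
  have h3 : (y - y') * (v.1 - w.1) = 0 := by linear_combination h2 - h1
  rcases mul_eq_zero.1 h3 with h4 | h4
  · exact sub_eq_zero.1 h4
  · exfalso; apply h
    have h5 : v.1 = w.1 := sub_eq_zero.1 h4
    refine Prod.ext h5 ?_
    rw [h5] at h1
    linear_combination h1

lemma er_fst_ne {K : Type} [Field K] {v w : K × K} (h : v ≠ w) {y : K}
    (h1 : v.2 - y * v.1 = w.2 - y * w.1) : w.1 - v.1 ≠ 0 := by
  intro h4
  apply h
  have h5 : v.1 = w.1 := (sub_eq_zero.1 h4).symm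
  refine Prod.ext h5 ?_
  rw [h5] at h1
  linear_combination h1

lemma er_rel {K : Type} [Field K] {a b c d : K × K} (hab : a ≠ b) (hac : a ≠ c) (had : a ≠ d)
    {ab ac ad bc bd cd : K}
    (e1 : a.2 - ab * a.1 = b.2 - ab * b.1) (e2 : a.2 - ac * a.1 = c.2 - ac * c.1)
    (e3 : a.2 - ad * a.1 = d.2 - ad * d.1) (e4 : b.2 - bc * b.1 = c.2 - bc * c.1)
    (e5 : b.2 - bd * b.1 = d.2 - bd * d.1) (e6 : c.2 - cd * c.1 = d.2 - cd * d.1) :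
    (ab - bc) * (ac - cd) * (ad - bd) = (ac - bc) * (ad - cd) * (ab - bd) := by
  have n1 := er_fst_ne hab e1
  have n2 := er_fst_ne hac e2
  have n3 := er_fst_ne had e3
  have f1 : (b.1 - a.1) * (ab - bc) = (c.1 - a.1) * (ac - bc) := by linear_combination e1 + e4 - e2
  have f2 : (b.1 - a.1) * (ab - bd) = (d.1 - a.1) * (ad - bd) := by linear_combination e1 + e5 - e3
  have f3 : (c.1 - a.1) * (ac - cd) = (d.1 - a.1) * (ad - cd) := by linear_combination e2 + e6 - e3
  have n4 : (b.1 - a.1) * (c.1 - a.1) * (d.1 - a.1) ≠ 0 := mul_ne_zero (mul_ne_zero n1 n2) n3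
  apply mul_left_cancel₀ n4
  calc _ = ((b.1 - a.1) * (ab - bc)) * ((c.1 - a.1) * (ac - cd)) * ((d.1 - a.1) * (ad - bd)) := by ring
    _ = ((c.1 - a.1) * (ac - bc)) * ((d.1 - a.1) * (ad - cd)) * ((b.1 - a.1) * (ab - bd)) := by
        rw [f1, f3, ← f2]
    _ = _ := by ring

open Classical in
lemma er_cliqueFree {K : Type} [Field K] (Y : Finset K) (hY : ERGood Y) (s : ℕ) (hs : 3 ≤ s)
    (χ : {y // y ∈ Y} × (K × K) → Fin s) : (erGraph (erLam Y) χ).CliqueFree (s + 2) := by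
  intro Q hQ
  have hcl : ∀ v ∈ Q, ∀ w ∈ Q, v ≠ w → (erGraph (erLam Y) χ).Adj v w :=
    fun v hv w hw hvw => hQ.1 hv hw hvw
  have hcard : Q.card = s + 2 := hQ.2
  have hσ : ∀ v w, ∃ y : K, v ∈ Q → w ∈ Q → v ≠ w → y ∈ Y ∧ v.2 - y * v.1 = w.2 - y * w.1 := by
    intro v w
    by_cases h : v ∈ Q ∧ w ∈ Q ∧ v ≠ w
    · obtain ⟨y, h1, _⟩ := hcl v h.1 w h.2.1 h.2.2
      exact ⟨y.1, fun _ _ _ => ⟨y.2, h1⟩⟩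
    · exact ⟨0, fun h1 h2 h3 => absurd ⟨h1, h2, h3⟩ h⟩
  choose σ hσ using hσ
  have hsym : ∀ v ∈ Q, ∀ w ∈ Q, v ≠ w → σ v w = σ w v := fun v hv w hw hvw =>
    er_net hvw (hσ v w hv hw hvw).2 (hσ w v hw hv hvw.symm).2.symm
  -- lines carry at most `s` points of `Q`
  have hline : ∀ y ∈ Y, ∀ l : K, (Q.filter (fun v => v.2 - y * v.1 = l)).card ≤ s := by
    intro y hy l
    rw [← Fintype.card_fin s, ← Finset.card_univ (α := Fin s)]
    refine Finset.card_le_card_of_injOn (fun v => χ (⟨y, hy⟩, v))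
      (fun _ _ => Finset.mem_coe.2 (Finset.mem_univ _)) ?_
    intro v hv w hw h
    have h1 := Finset.mem_filter.1 (Finset.mem_coe.1 hv)
    have h2 := Finset.mem_filter.1 (Finset.mem_coe.1 hw)
    by_contra hne
    obtain ⟨y', h3, h4⟩ := hcl v h1.1 w h2.1 hne
    have h5 : y = y'.1 := er_net hne (h1.2.trans h2.2.symm) h3
    have h6 : y' = ⟨y, hy⟩ := Subtype.ext h5.symm
    rw [h6] at h4
    exact h4 h
  -- four distinct points are never generic
  have hfour : ∀ a ∈ Q, ∀ b ∈ Q, ∀ c ∈ Q, ∀ d ∈ Q, a ≠ b → a ≠ c → a ≠ d → b ≠ c → b ≠ d → c ≠ d →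
      ¬ (σ a b ≠ σ a c ∧ σ a b ≠ σ a d ∧ σ a b ≠ σ b c ∧ σ a b ≠ σ b d ∧ σ a c ≠ σ a d ∧
        σ a c ≠ σ b c ∧ σ a c ≠ σ c d ∧ σ a d ≠ σ b d ∧ σ a d ≠ σ c d ∧
        σ b c ≠ σ b d ∧ σ b c ≠ σ c d ∧ σ b d ≠ σ c d) := by
    intro a ha b hb c hc d hd n1 n2 n3 n4 n5 n6 hall
    have g1 := hσ a b ha hb n1
    have g2 := hσ a c ha hc n2
    have g3 := hσ a d ha hd n3
    have g4 := hσ b c hb hc n4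
    have g5 := hσ b d hb hd n5
    have g6 := hσ c d hc hd n6
    exact hY _ g1.1 _ g2.1 _ g3.1 _ g4.1 _ g5.1 _ g6.1
      ⟨er_rel n1 n2 n3 g1.2 g2.2 g3.2 g4.2 g5.2 g6.2, hall⟩
  -- hence there are three collinear points
  have hthree : ∃ v ∈ Q, ∃ w ∈ Q, ∃ u ∈ Q, v ≠ w ∧ v ≠ u ∧ w ≠ u ∧ σ v w = σ v u := by
    by_contra hno
    push Not at hno
    obtain ⟨T, hTQ, hT⟩ := Finset.exists_subset_card_eq (s := Q) (n := 4) (by omega)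
    obtain ⟨a, b, c, d, n1, n2, n3, n4, n5, n6, rfl⟩ := Finset.card_eq_four.1 hT
    have ha : a ∈ Q := hTQ (by simp)
    have hb : b ∈ Q := hTQ (by simp)
    have hc : c ∈ Q := hTQ (by simp)
    have hd : d ∈ Q := hTQ (by simp)
    refine hfour a ha b hb c hc d hd n1 n2 n3 n4 n5 n6 ⟨?_, ?_, ?_, ?_, ?_, ?_, ?_, ?_, ?_, ?_, ?_, ?_⟩
    · exact hno a ha b hb c hc n1 n2 n4
    · exact hno a ha b hb d hd n1 n3 n5
    · rw [hsym a ha b hb n1]; exact hno b hb a ha c hc n1.symm n4 n2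
    · rw [hsym a ha b hb n1]; exact hno b hb a ha d hd n1.symm n5 n3
    · exact hno a ha c hc d hd n2 n3 n6
    · rw [hsym a ha c hc n2, hsym b hb c hc n4]; exact hno c hc a ha b hb n2.symm n4.symm n1
    · rw [hsym a ha c hc n2]; exact hno c hc a ha d hd n2.symm n6 n3
    · rw [hsym a ha d hd n3, hsym b hb d hd n5]; exact hno d hd a ha b hb n3.symm n5.symm n1
    · rw [hsym a ha d hd n3, hsym c hc d hd n6]; exact hno d hd a ha c hc n3.symm n6.symm n2
    · exact hno b hb c hc d hd n4 n5 n6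
    · rw [hsym b hb c hc n4]; exact hno c hc b hb d hd n4.symm n6 n5
    · rw [hsym b hb d hd n5, hsym c hc d hd n6]; exact hno d hd b hb c hc n5.symm n6.symm n4
  obtain ⟨v, hv, w, hw, u, hu, n1, n2, n3, huv⟩ := hthree
  set y := σ v w with hy
  set l := v.2 - y * v.1 with hl
  have hyY : y ∈ Y := (hσ v w hv hw n1).1
  set X := Q.filter (fun x => x.2 - y * x.1 = l) with hX
  have hX3 : 3 ≤ X.card := by
    have : ({v, w, u} : Finset (K × K)) ⊆ X := by
      intro x hx
      simp only [Finset.mem_insert, Finset.mem_singleton] at hx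
      rcases hx with rfl | rfl | rfl
      · exact Finset.mem_filter.2 ⟨hv, rfl⟩
      · exact Finset.mem_filter.2 ⟨hw, (hσ v _ hv hw n1).2.symm⟩
      · refine Finset.mem_filter.2 ⟨hu, ?_⟩
        rw [hl, huv]
        exact (hσ v _ hv hu n2).2.symm
    calc 3 = ({v, w, u} : Finset (K × K)).card := (Finset.card_eq_three.2 ⟨v, w, u, n1, n2, n3, rfl⟩).symm
      _ ≤ _ := Finset.card_le_card this
  have hXs : X.card ≤ s := hline y hyY l
  have hXQ : X ⊆ Q := Finset.filter_subset _ _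
  have hout : 1 < (Q \ X).card := by
    rw [Finset.card_sdiff_of_subset hXQ]; omega
  obtain ⟨c, hc, d, hd, ncd⟩ := Finset.one_lt_card.1 hout
  obtain ⟨hcQ, hcX⟩ := Finset.mem_sdiff.1 hc
  obtain ⟨hdQ, hdX⟩ := Finset.mem_sdiff.1 hd
  have hcl' : c.2 - y * c.1 ≠ l := fun h => hcX (Finset.mem_filter.2 ⟨hcQ, h⟩)
  have hdl' : d.2 - y * d.1 ≠ l := fun h => hdX (Finset.mem_filter.2 ⟨hdQ, h⟩)
  have hcd := hσ c d hcQ hdQ ncd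
  set y' := σ c d with hy'
  set Z := X.filter (fun x => x.2 - y' * x.1 = c.2 - y' * c.1) with hZ
  have hZ1 : Z.card ≤ 1 := by
    rw [Finset.card_le_one]
    intro x hx x' hx'
    by_contra hne
    have h1 := Finset.mem_filter.1 hx
    have h2 := Finset.mem_filter.1 hx'
    have h3 := Finset.mem_filter.1 h1.1
    have h4 := Finset.mem_filter.1 h2.1
    have h5 : y = y' := er_net hne (h3.2.trans h4.2.symm) (h1.2.trans h2.2.symm)
    apply hcl'
    rw [← h3.2, h5, h1.2]
  have hZX : Z ⊆ X := Finset.filter_subset _ _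
  have hXZ : 1 < (X \ Z).card := by
    rw [Finset.card_sdiff_of_subset hZX]; omega
  obtain ⟨a, ha, b, hb, nab⟩ := Finset.one_lt_card.1 hXZ
  obtain ⟨haX, haZ⟩ := Finset.mem_sdiff.1 ha
  obtain ⟨hbX, hbZ⟩ := Finset.mem_sdiff.1 hb
  obtain ⟨haQ, hal⟩ := Finset.mem_filter.1 haX
  obtain ⟨hbQ, hbl⟩ := Finset.mem_filter.1 hbX
  have hac' : a.2 - y' * a.1 ≠ c.2 - y' * c.1 := fun h => haZ (Finset.mem_filter.2 ⟨haX, h⟩)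
  have hbc' : b.2 - y' * b.1 ≠ c.2 - y' * c.1 := fun h => hbZ (Finset.mem_filter.2 ⟨hbX, h⟩)
  have nac : a ≠ c := by rintro rfl; exact hcl' hal
  have nad : a ≠ d := by rintro rfl; exact hdl' hal
  have nbc : b ≠ c := by rintro rfl; exact hcl' hbl
  have nbd : b ≠ d := by rintro rfl; exact hdl' hbl
  have gab := hσ a b haQ hbQ nab
  have gac := hσ a c haQ hcQ nac
  have gad := hσ a d haQ hdQ nad
  have gbc := hσ b c hbQ hcQ nbc
  have gbd := hσ b d hbQ hdQ nbd
  have eab : σ a b = y := er_net nab gab.2 (hal.trans hbl.symm)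
  have m1 : y ≠ σ a c := by intro h; rw [← h] at gac; exact hcl' (gac.2.symm.trans hal)
  have m2 : y ≠ σ a d := by intro h; rw [← h] at gad; exact hdl' (gad.2.symm.trans hal)
  have m3 : y ≠ σ b c := by intro h; rw [← h] at gbc; exact hcl' (gbc.2.symm.trans hbl)
  have m4 : y ≠ σ b d := by intro h; rw [← h] at gbd; exact hdl' (gbd.2.symm.trans hbl)
  have m5 : σ a c ≠ y' := by intro h; rw [h] at gac; exact hac' gac.2
  have m6 : σ a d ≠ y' := by intro h; rw [h] at gad; exact hac' (gad.2.trans hcd.2.symm)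
  have m7 : σ b c ≠ y' := by intro h; rw [h] at gbc; exact hbc' gbc.2
  have m8 : σ b d ≠ y' := by intro h; rw [h] at gbd; exact hbc' (gbd.2.trans hcd.2.symm)
  have m9 : σ a c ≠ σ a d := by
    intro h
    apply m5
    refine er_net ncd ?_ hcd.2
    rw [← gac.2, h, gad.2]
  have m10 : σ b c ≠ σ b d := by
    intro h
    apply m7
    refine er_net ncd ?_ hcd.2
    rw [← gbc.2, h, gbd.2]
  have m11 : σ a c ≠ σ b c := by
    intro h
    apply m1
    rw [← eab]
    refine er_net nab gab.2 ?_
    rw [gac.2, h, gbc.2]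
  have m12 : σ a d ≠ σ b d := by
    intro h
    apply m2
    rw [← eab]
    refine er_net nab gab.2 ?_
    rw [gad.2, h, gbd.2]
  refine hfour a haQ b hbQ c hcQ d hdQ nab nac nad nbc nbd ncd ?_
  rw [eab]
  exact ⟨m1, m2, m3, m4, m9, m11, m5, m12, m6, m10, m7, m8⟩

end ERPlane

section ERSample

lemma er_comap_cliqueFree {V W : Type} (G : SimpleGraph V) (f : W → V) (k : ℕ) (h : G.CliqueFree k) :
    (G.comap f).CliqueFree k := by
  classical
  intro Q hQ
  have hadj : ∀ v ∈ Q, ∀ w ∈ Q, v ≠ w → G.Adj (f v) (f w) := fun v hv w hw hvw => hQ.1 hv hw hvw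
  apply h (Q.image f)
  refine ⟨?_, ?_⟩
  · intro x hx y hy hxy
    obtain ⟨v, hv, rfl⟩ := Finset.mem_image.1 (Finset.mem_coe.1 hx)
    obtain ⟨w, hw, rfl⟩ := Finset.mem_image.1 (Finset.mem_coe.1 hy)
    exact hadj v hv w hw (fun e => hxy (by rw [e]))
  · rw [Finset.card_image_of_injOn, hQ.2]
    intro v hv w hw hvw
    by_contra hne
    exact (hadj v hv w hw hne).ne hvw

open Classical in
lemma er_comap_free {V W : Type} (G : SimpleGraph V) (f : W → V) (s : ℕ) (A : Finset W)
    (h : ((G.comap f).induce (A : Set W)).CliqueFree s) : ERFree G s (A.image f) := by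
  intro g hg
  by_contra hcon
  push Not at hcon
  have h1 : ∀ i, ∃ w : (A : Set W), f w = g i := by
    intro i
    obtain ⟨w, hw, e⟩ := Finset.mem_image.1 (hg i)
    exact ⟨⟨w, hw⟩, e⟩
  choose k hk using h1
  have hinj : Function.Injective k := by
    intro i j hij
    by_contra hne
    apply (hcon i j hne).ne
    rw [← hk i, ← hk j, hij]
  apply h (Finset.univ.map ⟨k, hinj⟩)
  refine ⟨?_, by simp⟩
  intro x hx y hy hxy
  simp only [Finset.coe_map, Function.Embedding.coeFn_mk, Finset.coe_univ, Set.image_univ,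
    Set.mem_range] at hx hy
  obtain ⟨i, rfl⟩ := hx
  obtain ⟨j, rfl⟩ := hy
  have := hcon i j (fun e => hxy (by rw [e]))
  rw [← hk i, ← hk j] at this
  exact this

open Classical in
lemma er_sample {V : Type} [Fintype V] (G : SimpleGraph V) (s t' n t B N : ℕ)
    (hG : G.CliqueFree t')
    (hcov : ERCovers (fun S => ERFree G s S) (fun D => D.card ≤ B) N) (htn : t ≤ n)
    (hlt : N * (n.choose t * (B ^ t * Fintype.card V ^ (n - t))) < Fintype.card V ^ n) :
    erdosRogers s t' n ≤ t := by
  obtain ⟨𝒟, h1, h2, h3⟩ := hcov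
  set E : Finset V → Finset (Fin n) → Finset (Fin n → V) := fun D A =>
    Fintype.piFinset (fun i => if i ∈ A then D else Finset.univ) with hE
  have hEc : ∀ D ∈ 𝒟, ∀ A ∈ Finset.powersetCard t (Finset.univ : Finset (Fin n)),
      (E D A).card ≤ B ^ t * Fintype.card V ^ (n - t) := by
    intro D hD A hA
    have hAc : A.card = t := (Finset.mem_powersetCard.1 hA).2
    rw [hE]
    simp only
    rw [Fintype.card_piFinset]
    have : ∀ i, (if i ∈ A then D else Finset.univ).card = if i ∈ A then D.card else Fintype.card V := by
      intro i; split_ifs <;> simp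
    simp only [this]
    rw [Finset.prod_ite]
    simp only [Finset.prod_const]
    have e1 : ((Finset.univ : Finset (Fin n)).filter (fun i => i ∈ A)).card = t := by
      rw [← hAc]; congr 1; ext i; simp
    have e2 : ((Finset.univ : Finset (Fin n)).filter (fun i => i ∉ A)).card = n - t := by
      have := Finset.card_filter_add_card_filter_not (s := (Finset.univ : Finset (Fin n))) (fun i => i ∈ A)
      rw [Finset.card_univ, Fintype.card_fin] at this
      omega
    rw [e1, e2]
    exact Nat.mul_le_mul_right _ (Nat.pow_le_pow_left (h2 D hD) _)
  set T := 𝒟.biUnion (fun D => (Finset.powersetCard t (Finset.univ : Finset (Fin n))).biUnion (E D)) with hT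
  have hTc : T.card < Fintype.card (Fin n → V) := by
    calc T.card ≤ 𝒟.card * (n.choose t * (B ^ t * Fintype.card V ^ (n - t))) := by
          refine Finset.card_biUnion_le_card_mul _ _ _ fun D hD => ?_
          refine (Finset.card_biUnion_le_card_mul _ _ _ (hEc D hD)).trans ?_
          rw [Finset.card_powersetCard, Finset.card_univ, Fintype.card_fin]
      _ ≤ N * (n.choose t * (B ^ t * Fintype.card V ^ (n - t))) := Nat.mul_le_mul_right _ h1
      _ < _ := by simpa using hlt
  obtain ⟨f, hf⟩ : ∃ f, f ∉ T := by
    by_contra hcon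
    push Not at hcon
    rw [Finset.eq_univ_of_forall hcon, Finset.card_univ] at hTc
    exact lt_irrefl _ hTc
  have hkey : sSup { m : ℕ | ∃ A : Finset (Fin n), A.card = m ∧
      ((G.comap f).induce (A : Set (Fin n))).CliqueFree s } ≤ t → erdosRogers s t' n ≤ t := by
    intro hk
    unfold erdosRogers
    exact le_trans (Nat.sInf_le ⟨G.comap f, er_comap_cliqueFree G f t' hG, rfl⟩) hk
  apply hkey
  apply csSup_le'
  rintro m ⟨A, rfl, hA⟩
  by_contra hcon
  push Not at hcon
  obtain ⟨A', hA', hA'c⟩ := Finset.exists_subset_card_eq hcon.le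
  obtain ⟨D, hD, hAD⟩ := h3 _ (er_comap_free G f s A hA)
  apply hf
  refine Finset.mem_biUnion.2 ⟨D, hD, Finset.mem_biUnion.2 ⟨A',
    Finset.mem_powersetCard.2 ⟨Finset.subset_univ _, hA'c⟩, ?_⟩⟩
  rw [hE]
  simp only
  rw [Fintype.mem_piFinset]
  intro i
  split_ifs with h
  · exact hAD (Finset.mem_image_of_mem f (hA' h))
  · exact Finset.mem_univ _

end ERSample

section ERFinite

lemma er_finite (s : ℕ) (hs : 3 ≤ s) : ∃ A C : ℕ, 0 < A ∧ ∀ p : ℕ, p.Prime → 2 < p →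
    ∀ L b k n t : ℕ, 0 < L → 5 * (L ^ s) ^ 5 < p →
    Real.exp (-((L ^ s : ℕ) : ℝ) / (8 * s)) * ((p * p : ℕ) : ℝ) ≤ 1 / 2 →
    16 * s * p ≤ b * L → (A - 1) ^ k * (p * p) ≤ A ^ k * (8 * s ^ 2 * p) → t ≤ n →
    ((p * p + 1) ^ (C * b)) ^ k * (n.choose t * ((8 * s ^ 2 * p) ^ t * (p * p) ^ (n - t))) < (p * p) ^ n →
    erdosRogers s (s + 2) n ≤ t := by
  classical
  obtain ⟨A, C, hA, hit⟩ := er_iterate s (by omega)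
  refine ⟨A, C, hA, ?_⟩
  intro p hp hp2 L b k n t hL hLp hexp hb hk htn hlt
  have : Fact p.Prime := ⟨hp⟩
  have h2 : (2 : ZMod p) ≠ 0 := by
    intro h
    have h' : ((2 : ℕ) : ZMod p) = 0 := by exact_mod_cast h
    rw [ZMod.natCast_eq_zero_iff] at h'
    have := Nat.le_of_dvd (by norm_num) h'
    omega
  have hcK : Fintype.card (ZMod p) = p := ZMod.card p
  have hcV : Fintype.card (ZMod p × ZMod p) = p * p := by rw [Fintype.card_prod, hcK]
  obtain ⟨Y, hYc, hY⟩ := er_slopes (K := ZMod p) h2 (L ^ s) (by rw [hcK]; exact hLp)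
  have hκ : Fintype.card {y // y ∈ Y} = L ^ s := by rw [Fintype.card_coe, hYc]
  obtain ⟨χ, hχ⟩ := er_colour (erLam Y) s (by omega) (by rw [hκ, hcV]; exact hexp)
  have hcov := hit _ _ _ (erLam Y) (by
    intro v w hvw y y' h1 h2
    exact Subtype.ext (er_net hvw h1 h2)) (by rw [hcK]; omega) χ hχ L b hL hκ (by rw [hcK]; exact hb) k
  rw [hcV, hcK] at hcov
  refine er_sample (erGraph (erLam Y) χ) s (s + 2) n t (8 * s ^ 2 * p) _
    (er_cliqueFree Y hY s hs χ) (hcov.mono (fun _ h => h) ?_ le_rfl) htn (by rw [hcV]; exact hlt)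
  rintro D (h | h)
  · exact h.le
  · exact Nat.le_of_mul_le_mul_left (h.trans hk) (by positivity)

lemma er_ev_log (K : ℝ) : ∀ᶠ p : ℕ in Filter.atTop, K ≤ Real.log p :=
  (Real.tendsto_log_atTop.comp tendsto_natCast_atTop_atTop).eventually_ge_atTop K

lemma er_ev_pow (K : ℝ) (hK : 0 < K) (m : ℕ) : ∀ᶠ p : ℕ in Filter.atTop, K * Real.log p ^ m ≤ p := by
  have h := (Real.isLittleO_pow_log_id_atTop (n := m)).def (inv_pos.2 hK)
  have h' := tendsto_natCast_atTop_atTop (R := ℝ) |>.eventually h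
  filter_upwards [h'] with p hp
  simp only [Real.norm_eq_abs, id] at hp
  rw [abs_of_nonneg (a := (p : ℝ)) (Nat.cast_nonneg p)] at hp
  have h2 := (le_abs_self _).trans hp
  rw [inv_mul_eq_div, le_div_iff₀ hK] at h2
  linarith

set_option maxHeartbeats 1000000 in
lemma er_params (s A C : ℕ) (hs : 3 ≤ s) (hA : 0 < A) (c : ℝ) (hc : 0 < c) :
    ∀ᶠ p : ℕ in Filter.atTop, ∃ L b k : ℕ, 0 < L ∧ 5 * (L ^ s) ^ 5 < p ∧
    Real.exp (-((L ^ s : ℕ) : ℝ) / (8 * s)) * ((p * p : ℕ) : ℝ) ≤ 1 / 2 ∧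
    16 * s * p ≤ b * L ∧ (A - 1) ^ k * (p * p) ≤ A ^ k * (8 * s ^ 2 * p) ∧
    Real.log (((p * p + 1) ^ (C * b)) ^ k : ℕ) < c * p := by
  have hs' : (3 : ℝ) ≤ s := by exact_mod_cast hs
  have hA' : (1 : ℝ) ≤ A := by exact_mod_cast hA
  filter_upwards [er_ev_log 2, er_ev_log (48 * s), er_ev_log (4 * (6 * A * C * 32 * s) / c + 1),
    er_ev_pow 6 (by norm_num) (15 * s), er_ev_pow (4 * (6 * A * C + 1) / c) (by positivity) 2,
    Filter.eventually_ge_atTop 3]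
    with p hl2 hl48 hlc hp15 hpc hp3
  set l := Real.log p with hl
  have hp0 : (0 : ℝ) < p := by positivity
  have hp1 : (3 : ℝ) ≤ p := by exact_mod_cast hp3
  have hpe : (p : ℝ) = Real.exp l := (Real.exp_log hp0).symm
  have hl0 : 0 < l := by linarith
  have hl3 : (8 : ℝ) ≤ l ^ 3 := by
    calc (8 : ℝ) = 2 ^ 3 := by norm_num
      _ ≤ l ^ 3 := by gcongr
  set L := ⌊l ^ 3⌋₊ with hL
  have hL1 : (L : ℝ) ≤ l ^ 3 := Nat.floor_le (by positivity)
  have hL2 : l ^ 3 / 2 ≤ L := by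
    have := Nat.lt_floor_add_one (l ^ 3); linarith
  have hL0 : 0 < L := by
    have : (0 : ℝ) < L := by linarith
    exact_mod_cast this
  set k := ⌈A * l⌉₊ with hk
  have hk1 : A * l ≤ k := Nat.le_ceil _
  have hk2 : (k : ℝ) ≤ A * l + 1 := (Nat.ceil_lt_add_one (by positivity)).le
  set b := 16 * s * p / L + 1 with hb
  have hb1 : (b : ℝ) ≤ 16 * s * p / L + 1 := by
    have := Nat.cast_div_le (α := ℝ) (m := 16 * s * p) (n := L)
    rw [hb]; push_cast at this ⊢; linarith
  refine ⟨L, b, k, hL0, ?_, ?_, ?_, ?_, ?_⟩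
  · have h1 : (5 * ((L : ℝ) ^ s) ^ 5) < p := by
      calc 5 * ((L : ℝ) ^ s) ^ 5 ≤ 5 * ((l ^ 3) ^ s) ^ 5 := by gcongr
        _ = 5 * l ^ (15 * s) := by rw [← pow_mul, ← pow_mul]; congr 2; ring
        _ < 6 * l ^ (15 * s) := by
            have : 0 < l ^ (15 * s) := by positivity
            linarith
        _ ≤ p := hp15
    exact_mod_cast h1
  · have h1 : 8 * s * (2 * l + 1) ≤ ((L ^ s : ℕ) : ℝ) := by
      have h2 : (L : ℝ) ≤ ((L ^ s : ℕ) : ℝ) := by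
        exact_mod_cast Nat.le_self_pow (by omega) L
      have h3 : 48 * s * l ≤ l ^ 2 * l := by
        have : 48 * s ≤ l ^ 2 := by nlinarith
        gcongr
      nlinarith
    have h2 : -((L ^ s : ℕ) : ℝ) / (8 * s) ≤ -(2 * l + 1) := by
      rw [div_le_iff₀ (by positivity)]; linarith
    calc Real.exp (-((L ^ s : ℕ) : ℝ) / (8 * s)) * ((p * p : ℕ) : ℝ)
        ≤ Real.exp (-(2 * l + 1)) * ((p * p : ℕ) : ℝ) := by gcongr
      _ = Real.exp (-1) := by
          push_cast; rw [hpe, ← Real.exp_add, ← Real.exp_add]; congr 1; ring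
      _ ≤ 1 / 2 := by
          have := Real.add_one_le_exp (1 : ℝ)
          rw [Real.exp_neg, one_div]
          exact inv_anti₀ (by norm_num) (by linarith)
  · have := Nat.lt_mul_div_succ (16 * s * p) hL0
    rw [mul_comm b L]; exact this.le
  · have h1 : ((A : ℝ) - 1) ^ k * (p * p) ≤ A ^ k * (8 * s ^ 2 * p) := by
      have h2 : (A : ℝ) - 1 ≤ A * Real.exp (-(1 / A)) := by
        have := Real.add_one_le_exp (-(1 / A) : ℝ)
        have h3 : (A : ℝ) * (-(1 / A) + 1) ≤ A * Real.exp (-(1 / A)) := by gcongr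
        have h4 : (A : ℝ) * (-(1 / A) + 1) = A - 1 := by field_simp; ring
        linarith
      have h3 : Real.exp (-(1 / A)) ^ k * p ≤ 1 := by
        rw [← Real.exp_nat_mul, hpe, ← Real.exp_add]
        apply Real.exp_le_one_iff.2
        have : l ≤ k / A := by rw [le_div_iff₀ (by positivity)]; linarith
        have h5 : (k : ℝ) * -(1 / A) = -(k / A) := by ring
        linarith
      calc ((A : ℝ) - 1) ^ k * (p * p) ≤ (A * Real.exp (-(1 / A))) ^ k * (p * p) := by
            have : (0 : ℝ) ≤ A - 1 := by linarith
            gcongr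
        _ = A ^ k * ((Real.exp (-(1 / A)) ^ k * p) * p) := by rw [mul_pow]; ring
        _ ≤ A ^ k * (1 * p) := by gcongr
        _ ≤ A ^ k * (8 * s ^ 2 * p) := by gcongr; nlinarith
    have h2 : (((A - 1 : ℕ) : ℝ)) = A - 1 := by rw [Nat.cast_sub hA]; simp
    rw [← h2] at h1
    exact_mod_cast h1
  · have h1 : Real.log ((p * p + 1 : ℕ) : ℝ) ≤ 3 * l := by
      have : ((p * p + 1 : ℕ) : ℝ) ≤ (p : ℝ) ^ 3 := by push_cast; nlinarith
      calc Real.log ((p * p + 1 : ℕ) : ℝ) ≤ Real.log ((p : ℝ) ^ 3) :=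
            Real.log_le_log (by positivity) this
        _ = 3 * l := by rw [Real.log_pow, hl]; norm_num
    have h2 : Real.log (((p * p + 1) ^ (C * b)) ^ k : ℕ) = k * (C * b * Real.log ((p * p + 1 : ℕ) : ℝ)) := by
      rw [Nat.cast_pow, Real.log_pow, Nat.cast_pow, Real.log_pow]; push_cast; ring
    rw [h2]
    have hb2 : (b : ℝ) ≤ 32 * s * p / l ^ 3 + 1 := by
      refine hb1.trans ?_
      gcongr ?_ + 1
      rw [div_le_div_iff₀ (by linarith) (by positivity)]
      have : 16 * s * p * l ^ 3 = 32 * s * p * (l ^ 3 / 2) := by ring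
      rw [this]; gcongr
    have hk3 : (k : ℝ) ≤ 2 * A * l := by nlinarith
    have h3 : (k : ℝ) * (C * b * Real.log ((p * p + 1 : ℕ) : ℝ)) ≤
        (2 * A * l) * (C * (32 * s * p / l ^ 3 + 1) * (3 * l)) := by gcongr
    have h4 : (2 * A * l) * (C * (32 * s * p / l ^ 3 + 1) * (3 * l))
        = (6 * A * C * 32 * s) / l * p + 6 * A * C * l ^ 2 := by field_simp; ring
    have h5 : (6 * A * C * 32 * s) / l ≤ c / 4 := by
      rw [div_le_iff₀ hl0]
      have : 4 * (6 * A * C * 32 * s) / c ≤ l := by linarith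
      rw [div_le_iff₀ hc] at this
      linarith
    have h6 : 6 * A * C * l ^ 2 ≤ c / 4 * p := by
      have h7 : 4 * (6 * A * C + 1) / c * l ^ 2 = (4 * (6 * A * C + 1) * l ^ 2) / c := by ring
      rw [h7, div_le_iff₀ hc] at hpc
      have h9 : 4 * (6 * A * C + 1) * l ^ 2 = 4 * (6 * A * C * l ^ 2) + 4 * l ^ 2 := by ring
      linarith [sq_nonneg l]
    have h8 : (6 * A * C * 32 * s) / l * p ≤ c / 4 * p := by gcongr
    have : 0 < c * p := by positivity
    linarith

end ERFinite

section ERFinal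

lemma er_final_ineq (N n t B p : ℕ) (htn : t ≤ n) (ht : 0 < t) (hp : 0 < p) (hN0 : 0 < N)
    (hN : Real.log N < t) (h : (n : ℝ) * Real.exp 2 * B ≤ t * p) :
    N * (n.choose t * ((B * p) ^ t * (p * p) ^ (n - t))) < (p * p) ^ n := by
  have hN' : (N : ℝ) < Real.exp t := by
    rw [← Real.exp_log (show (0 : ℝ) < N by exact_mod_cast hN0)]
    exact Real.exp_lt_exp.2 hN
  have htR : (0 : ℝ) < t := by exact_mod_cast ht
  have hpR : (0 : ℝ) < p := by exact_mod_cast hp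
  have h1 : (n.choose t : ℝ) ≤ (n : ℝ) ^ t * (Real.exp t / (t : ℝ) ^ t) := by
    have h2 : (n.choose t : ℝ) ≤ (n : ℝ) ^ t / (t.factorial : ℝ) := Nat.choose_le_pow_div t n
    have h3 := Real.pow_div_factorial_le_exp (t : ℝ) htR.le t
    refine h2.trans ?_
    rw [div_eq_mul_inv]
    gcongr
    have hf : (0 : ℝ) < t.factorial := by exact_mod_cast Nat.factorial_pos t
    rw [le_div_iff₀ (by positivity), inv_mul_eq_div]
    exact h3
  have h4 : (n : ℝ) * Real.exp 1 * (B * p) / t ≤ p * p * Real.exp (-1) := by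
    rw [div_le_iff₀ htR]
    have e2 : Real.exp 2 = Real.exp 1 * Real.exp 1 := by rw [← Real.exp_add]; norm_num
    have e0 : Real.exp 1 * Real.exp (-1) = 1 := by rw [← Real.exp_add]; norm_num
    have hm : 0 < Real.exp (-1) := Real.exp_pos _
    calc (n : ℝ) * Real.exp 1 * (B * p) = (n * Real.exp 2 * B) * (p * Real.exp (-1)) := by
          rw [e2]
          linear_combination (-(n : ℝ) * Real.exp 1 * B * p) * e0
      _ ≤ (t * p) * (p * Real.exp (-1)) := by gcongr
      _ = _ := by ring
  have h5 : (n.choose t : ℝ) * ((B * p : ℝ) ^ t) ≤ (p * p : ℝ) ^ t * Real.exp (-t) := by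
    calc (n.choose t : ℝ) * ((B * p : ℝ) ^ t)
        ≤ ((n : ℝ) ^ t * (Real.exp t / (t : ℝ) ^ t)) * ((B * p : ℝ) ^ t) := by gcongr
      _ = ((n : ℝ) * Real.exp 1 * (B * p) / t) ^ t := by
          have e1 : Real.exp (t : ℝ) = Real.exp 1 ^ t := by rw [← Real.exp_nat_mul, mul_one]
          rw [e1, div_pow]; simp only [mul_pow]; ring
      _ ≤ (p * p * Real.exp (-1)) ^ t := by gcongr
      _ = (p * p : ℝ) ^ t * Real.exp (-t) := by
          rw [mul_pow, ← Real.exp_nat_mul]; congr 2; ring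
  have h6 : (N : ℝ) * (n.choose t * ((B * p : ℝ) ^ t * (p * p : ℝ) ^ (n - t))) < (p * p : ℝ) ^ n := by
    calc (N : ℝ) * (n.choose t * ((B * p : ℝ) ^ t * (p * p : ℝ) ^ (n - t)))
        = N * ((n.choose t * (B * p : ℝ) ^ t) * (p * p : ℝ) ^ (n - t)) := by ring
      _ ≤ N * (((p * p : ℝ) ^ t * Real.exp (-t)) * (p * p : ℝ) ^ (n - t)) := by gcongr
      _ = (N * Real.exp (-t)) * ((p * p : ℝ) ^ t * (p * p : ℝ) ^ (n - t)) := by ring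
      _ = (N * Real.exp (-t)) * (p * p : ℝ) ^ n := by rw [← pow_add, Nat.add_sub_cancel' htn]
      _ < 1 * (p * p : ℝ) ^ n := by
          gcongr
          rw [Real.exp_neg, ← div_eq_mul_inv, div_lt_one (Real.exp_pos _)]
          exact hN'
      _ = _ := one_mul _
  exact_mod_cast h6

lemma er_upper (s : ℕ) (hs : 3 ≤ s) (δ : ℝ) (hδ : 0 < δ) :
    ∀ᶠ n : ℕ in Filter.atTop, (erdosRogers s (s + 2) n : ℝ) ≤ δ * Real.sqrt n + 1 := by
  obtain ⟨A, C, hA, hfin⟩ := er_finite s hs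
  have hs' : (3 : ℝ) ≤ s := by exact_mod_cast hs
  set κ : ℝ := Real.exp 2 * (8 * s ^ 2) / δ with hκ
  have hκ0 : 0 < κ := by positivity
  obtain ⟨p0, hp0⟩ := Filter.eventually_atTop.1 (er_params s A C hs hA (δ / (4 * κ)) (by positivity))
  have hsq : Filter.Tendsto (fun n : ℕ => Real.sqrt n) Filter.atTop Filter.atTop :=
    Real.tendsto_sqrt_atTop.comp tendsto_natCast_atTop_atTop
  filter_upwards [hsq.eventually_ge_atTop (p0 / κ), hsq.eventually_ge_atTop (4 / κ),
    hsq.eventually_ge_atTop δ, hsq.eventually_ge_atTop 1] with n h1 h2 h3 h4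
  set r := Real.sqrt n with hr
  have hrr : r * r = n := Real.mul_self_sqrt (Nat.cast_nonneg n)
  set t := ⌈δ * r⌉₊ with ht
  have ht1 : δ * r ≤ t := Nat.le_ceil _
  have ht2 : (t : ℝ) ≤ δ * r + 1 := (Nat.ceil_lt_add_one (by positivity)).le
  have ht0 : 0 < t := Nat.ceil_pos.2 (by positivity)
  have htn : t ≤ n := by
    apply Nat.ceil_le.2
    rw [← hrr]; gcongr
  set P := ⌈κ * r⌉₊ + 2 with hP
  have hP1 : κ * r ≤ P := by
    have := Nat.le_ceil (κ * r); rw [hP]; push_cast; linarith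
  have hP2 : (P : ℝ) ≤ κ * r + 3 := by
    have := (Nat.ceil_lt_add_one (show 0 ≤ κ * r by positivity)).le
    rw [hP]; push_cast; linarith
  obtain ⟨p, hp, hPp, hpP⟩ := Nat.exists_prime_lt_and_le_two_mul P (by omega)
  have hPpR : (P : ℝ) ≤ p := by exact_mod_cast hPp.le
  have hpPR : (p : ℝ) ≤ 2 * P := by exact_mod_cast hpP
  have hpp0 : p0 ≤ p := by
    have : (p0 : ℝ) ≤ p := by
      rw [div_le_iff₀ hκ0] at h1; linarith
    exact_mod_cast this
  obtain ⟨L, b, k, hL, hL5, hexp, hbL, hk, hlog⟩ := hp0 p hpp0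
  have hcp : δ / (4 * κ) * p ≤ δ * r := by
    rw [div_mul_eq_mul_div, div_le_iff₀ (by positivity)]
    rw [div_le_iff₀ hκ0] at h2
    have : (p : ℝ) ≤ r * (4 * κ) := by linarith
    calc δ * p ≤ δ * (r * (4 * κ)) := by gcongr
      _ = _ := by ring
  have hmain := hfin p hp (by omega) L b k n t hL hL5 hexp hbL hk htn
    (er_final_ineq _ n t (8 * s ^ 2) p htn ht0 hp.pos (by positivity) (by linarith) (by
      push_cast
      calc (n : ℝ) * Real.exp 2 * (8 * s ^ 2) = (δ * r) * (κ * r) := by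
            rw [← hrr, hκ]; field_simp
        _ ≤ t * p := by
            have : κ * r ≤ p := hP1.trans hPpR
            gcongr))
  have : (erdosRogers s (s + 2) n : ℝ) ≤ t := by exact_mod_cast hmain
  linarith

end ERFinal

/-- For every integer `s ≥ 3`, `f_{s,s+2}(n) = o(n^{1/2})`, i.e.
`f_{s,s+2}(n)/n^{1/2} → 0` as `n → ∞`. -/
theorem erdosRogers_s_sPlusTwo_littleO (s : ℕ) (hs : 3 ≤ s) :
    Filter.Tendsto (fun n : ℕ => (erdosRogers s (s + 2) n : ℝ) / (n : ℝ) ^ ((1 : ℝ) / 2))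
      Filter.atTop (nhds 0) := by
  rw [Metric.tendsto_nhds]
  intro ε hε
  have hsq : Filter.Tendsto (fun n : ℕ => Real.sqrt n) Filter.atTop Filter.atTop :=
    Real.tendsto_sqrt_atTop.comp tendsto_natCast_atTop_atTop
  filter_upwards [er_upper s hs (ε / 2) (by positivity), hsq.eventually_gt_atTop (2 / ε),
    hsq.eventually_ge_atTop 1] with n h1 h2 h3
  rw [← Real.sqrt_eq_rpow, Real.dist_eq, sub_zero, abs_of_nonneg (by positivity)]
  rw [div_lt_iff₀ (by linarith)]
  rw [div_lt_iff₀ hε] at h2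
  linarith
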